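/- arXiv:1408.1458 — 10 statements merged into one kernel-verified Lean document; each statement's English description precedes it below -/
import Mathlib

section
/- There is no algorithm which, given (an encoding of) a queue machine M, decides whether M terminates from its initial configuration (q1, $); i.e., under any natural encoding of queue machines (say with states and alphabet letters given as initial segments of the natural numbers) as natural numbers, the predicate 'M terminates from (q1, $)' is not a computable (decidable) predicate. -/
/-- A concrete, naturally encodable representation of a queue machine: states are
`0, ..., nQ-1` and letters are `0, ..., nA-1` (initial segments of ℕ), and the
partial transition functions `δ0, δ1, δ2` are given by (flattened) tables. -/
structure QMTable where
  nQ : ℕ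
  nA : ℕ
  dollar : ℕ
  q1 : ℕ
  t0 : List (Option (ℕ × ℕ))
  t1 : List (Option (ℕ × ℕ))
  t2 : List (Option (ℕ × ℕ))

def qmTableEquiv :
    QMTable ≃ ℕ × ℕ × ℕ × ℕ × List (Option (ℕ × ℕ)) × List (Option (ℕ × ℕ)) × List (Option (ℕ × ℕ)) where
  toFun T := (T.nQ, T.nA, T.dollar, T.q1, T.t0, T.t1, T.t2)
  invFun p := ⟨p.1, p.2.1, p.2.2.1, p.2.2.2.1, p.2.2.2.2.1, p.2.2.2.2.2.1, p.2.2.2.2.2.2⟩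
  left_inv T := rfl
  right_inv p := rfl

/-- The natural encoding of queue machines as natural numbers. -/
instance : Primcodable QMTable := Primcodable.ofEquiv _ qmTableEquiv

/-- `δ0` of the encoded machine. -/
def QMTable.d0 (T : QMTable) (q : ℕ) : Option (ℕ × ℕ) := T.t0.getD q none
/-- `δ1` of the encoded machine. -/
def QMTable.d1 (T : QMTable) (q a : ℕ) : Option (ℕ × ℕ) := T.t1.getD (q * T.nA + a) none
/-- `δ2` of the encoded machine. -/
def QMTable.d2 (T : QMTable) (q a b : ℕ) : Option (ℕ × ℕ) :=
  T.t2.getD ((q * T.nA + a) * T.nA + b) none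

/-- The table is a well-formed queue machine: everything in range, and the three
partial transition functions are disjointly defined and jointly total. -/
structure QMTable.Valid (T : QMTable) : Prop where
  hQ : 0 < T.nQ
  hA : 0 < T.nA
  hdollar : T.dollar < T.nA
  hq1 : T.q1 < T.nQ
  range0 : ∀ q < T.nQ, ∀ p ∈ T.d0 q, p.1 < T.nQ ∧ p.2 < T.nA
  range1 : ∀ q < T.nQ, ∀ a < T.nA, ∀ p ∈ T.d1 q a, p.1 < T.nQ ∧ p.2 < T.nA
  range2 : ∀ q < T.nQ, ∀ a < T.nA, ∀ b < T.nA, ∀ p ∈ T.d2 q a b, p.1 < T.nQ ∧ p.2 < T.nA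
  exactOne : ∀ q < T.nQ, ∀ a < T.nA, ∀ b < T.nA,
      ((T.d0 q).isSome ∧ T.d1 q a = none ∧ T.d2 q a b = none) ∨
      (T.d0 q = none ∧ (T.d1 q a).isSome ∧ T.d2 q a b = none) ∨
      (T.d0 q = none ∧ T.d1 q a = none ∧ (T.d2 q a b).isSome)

/-- The step relation on configurations `(q, w)`. -/
inductive QMTable.Step (T : QMTable) : ℕ × List ℕ → ℕ × List ℕ → Prop
  | step0 {q w q' c} : T.d0 q = some (q', c) → QMTable.Step T (q, w) (q', w ++ [c])
  | step1 {q a w q' c} : T.d0 q = none → T.d1 q a = some (q', c) →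
      QMTable.Step T (q, a :: w) (q', w ++ [c])
  | step2 {q a b w q' c} : T.d0 q = none → T.d1 q a = none → T.d2 q a b = some (q', c) →
      QMTable.Step T (q, a :: b :: w) (q', w ++ [c])

/-- `T` terminates from the initial configuration `(q1, [$])`. -/
def QMTable.Terminates (T : QMTable) : Prop :=
  ∃ cfg, Relation.ReflTransGen T.Step (T.q1, [T.dollar]) cfg ∧ ∀ c', ¬ T.Step cfg c'


namespace QMUndec

open StateTransition

/-! ### Abstract queue machines -/

/-- The action of a state: push, or read one letter and then push or read another one. -/
abbrev Act (S A : Type) := (S × A) ⊕ (A → (S × A) ⊕ (A → S × A))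

/-- The step function of an abstract queue machine. -/
def astep {S A : Type} (act : S → Act S A) : S × List A → Option (S × List A)
  | (s, w) =>
    match act s with
    | .inl p => some (p.1, w ++ [p.2])
    | .inr f =>
      match w with
      | [] => none
      | a :: w =>
        match f a with
        | .inl p => some (p.1, w ++ [p.2])
        | .inr g =>
          match w with
          | [] => none
          | b :: w => some ((g b).1, w ++ [(g b).2])

section table

set_option linter.unusedSectionVars false

variable {S A : Type} (act : S → Act S A)

def D0 (s : S) : Option (S × A) :=
  match act s with
  | .inl p => some p
  | .inr _ => none

def D1 (s : S) (a : A) : Option (S × A) :=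
  match act s with
  | .inl _ => none
  | .inr f =>
    match f a with
    | .inl p => some p
    | .inr _ => none

def D2 (s : S) (a b : A) : Option (S × A) :=
  match act s with
  | .inl _ => none
  | .inr f =>
    match f a with
    | .inl _ => none
    | .inr g => some (g b)

variable {N m : ℕ} (eS : S ≃ Fin N) (eA : A ≃ Fin m) [Inhabited S] [Inhabited A]

def num (p : S × A) : ℕ × ℕ := ((eS p.1 : ℕ), (eA p.2 : ℕ))

def decS (q : ℕ) : S := if h : q < N then eS.symm ⟨q, h⟩ else default


theorem decS_num (s : S) : decS eS (eS s : ℕ) = s := by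
  simp [decS]

/-- The successor of the `i`th state of the prologue. -/
def pst (N s0 i : ℕ) : ℕ := if i = 0 then s0 else N + i - 1

def tab1 : List (Option (ℕ × ℕ)) :=
  (List.range (N * m)).map fun i =>
    (D1 act (decS eS (i / m)) (decS eA (i % m))).map (num eS eA)

def tab2 : List (Option (ℕ × ℕ)) :=
  (List.range (N * m * m)).map fun i =>
    (D2 act (decS eS (i / m / m)) (decS eA (i / m % m)) (decS eA (i % m))).map (num eS eA)

def tab0 : List (Option (ℕ × ℕ)) :=
  (List.range N).map fun i => (D0 act (decS eS i)).map (num eS eA)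

/-- The table of an abstract machine with a prologue which pushes the letters of `pl.reverse`. -/
def mkTab (N m dollar s0 : ℕ) (l0 l1 l2 : List (Option (ℕ × ℕ))) (pl : List ℕ) : QMTable where
  nQ := N + pl.length
  nA := m
  dollar := dollar
  q1 := pst N s0 pl.length
  t0 := l0 ++ (List.range pl.length).map fun i => some (pst N s0 i, pl.getD i 0)
  t1 := l1
  t2 := l2

def theTab (d : A) (s0 : S) (pl : List A) : QMTable :=
  mkTab N m (eA d) (eS s0) (tab0 act eS eA) (tab1 act eS eA) (tab2 act eS eA)
    (pl.map fun a => (eA a : ℕ))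

variable (d : A) (s0 : S) (pl : List A)

theorem getD_map_range {β : Type} (n : ℕ) (f : ℕ → Option β) (i : ℕ) :
    ((List.range n).map f).getD i none = if i < n then f i else none := by
  by_cases h : i < n <;> simp [List.getD, h]

theorem theTab_d0_lt {q : ℕ} (hq : q < N) :
    (theTab act eS eA d s0 pl).d0 q = (D0 act (decS eS q)).map (num eS eA) := by
  simp only [QMTable.d0, theTab, mkTab, tab0]
  rw [List.getD_append _ _ _ _ (by simpa using hq), getD_map_range, if_pos hq]

theorem theTab_d0_ge (i : ℕ) (hi : i < pl.length) :
    (theTab act eS eA d s0 pl).d0 (N + i) = some (pst N (eS s0) i, (eA pl[i] : ℕ)) := by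
  simp only [QMTable.d0, theTab, mkTab, tab0]
  rw [List.getD_append_right _ _ _ _ (by simp), getD_map_range]
  simp [hi]

theorem theTab_d1 {q a : ℕ} (ha : a < m) :
    (theTab act eS eA d s0 pl).d1 q a =
      if q < N then (D1 act (decS eS q) (decS eA a)).map (num eS eA) else none := by
  have hm : 0 < m := by omega
  have h1 : (q * m + a) / m = q := by
    rw [mul_comm, Nat.mul_add_div hm, Nat.div_eq_of_lt ha, add_zero]
  have h2 : (q * m + a) % m = a := by
    rw [mul_comm, Nat.mul_add_mod, Nat.mod_eq_of_lt ha]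
  have h3 : q * m + a < N * m ↔ q < N := by
    rw [← Nat.div_lt_iff_lt_mul hm, h1]
  simp only [QMTable.d1, theTab, mkTab, tab1]
  rw [getD_map_range, h1, h2]
  simp only [h3]

theorem theTab_d2 {q a b : ℕ} (ha : a < m) (hb : b < m) :
    (theTab act eS eA d s0 pl).d2 q a b =
      if q < N then (D2 act (decS eS q) (decS eA a) (decS eA b)).map (num eS eA) else none := by
  have hm : 0 < m := by omega
  have h1 : ∀ x y : ℕ, y < m → (x * m + y) / m = x := fun x y hy => by
    rw [mul_comm, Nat.mul_add_div hm, Nat.div_eq_of_lt hy, add_zero]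
  have h2 : ∀ x y : ℕ, y < m → (x * m + y) % m = y := fun x y hy => by
    rw [mul_comm, Nat.mul_add_mod, Nat.mod_eq_of_lt hy]
  have h3 : (q * m + a) * m + b < N * m * m ↔ q < N := by
    rw [← Nat.div_lt_iff_lt_mul hm, h1 _ _ hb, ← Nat.div_lt_iff_lt_mul hm, h1 _ _ ha]
  simp only [QMTable.d2, theTab, mkTab, tab2]
  rw [getD_map_range, h1 _ _ hb, h1 _ _ ha, h2 _ _ hb, h2 _ _ ha]
  simp only [h3]

theorem pst_lt (i : ℕ) (hi : i ≤ pl.length) : pst N (eS s0) i < N + pl.length := by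
  have := (eS s0).2
  unfold pst
  split <;> omega

theorem num_lt (p : S × A) :
    (num eS eA p).1 < N + pl.length ∧ (num eS eA p).2 < m := by
  have h1 := (eS p.1).2
  have h2 := (eA p.2).2
  simp only [num]
  omega

theorem theTab_valid : (theTab act eS eA d s0 pl).Valid := by
  have hA : (theTab act eS eA d s0 pl).nA = m := rfl
  have hQ : (theTab act eS eA d s0 pl).nQ = N + pl.length := by simp [theTab, mkTab]
  refine ⟨?_, ?_, ?_, ?_, ?_, ?_, ?_, ?_⟩
  · rw [hQ]; have := (eS s0).2; omega
  · rw [hA]; have := (eA d).2; omega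
  · exact (eA d).2
  · rw [hQ]; simpa [theTab, mkTab] using pst_lt eS s0 pl pl.length le_rfl
  · rw [hQ, hA]
    intro q hq p hp
    by_cases h : q < N
    · rw [theTab_d0_lt _ _ _ _ _ _ h] at hp
      simp only [Option.mem_def, Option.map_eq_some_iff] at hp
      obtain ⟨x, _, rfl⟩ := hp
      exact num_lt eS eA pl x
    · obtain ⟨i, rfl⟩ := Nat.exists_eq_add_of_le (not_lt.1 h)
      rw [theTab_d0_ge _ _ _ _ _ _ i (by omega)] at hp
      simp only [Option.mem_def, Option.some.injEq] at hp
      subst hp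
      exact ⟨pst_lt eS s0 pl i (by omega), (eA _).2⟩
  · rw [hQ, hA]
    intro q hq a ha p hp
    rw [theTab_d1 _ _ _ _ _ _ ha] at hp
    split at hp
    · simp only [Option.mem_def, Option.map_eq_some_iff] at hp
      obtain ⟨x, _, rfl⟩ := hp
      exact num_lt eS eA pl x
    · simp at hp
  · rw [hQ, hA]
    intro q hq a ha b hb p hp
    rw [theTab_d2 _ _ _ _ _ _ ha hb] at hp
    split at hp
    · simp only [Option.mem_def, Option.map_eq_some_iff] at hp
      obtain ⟨x, _, rfl⟩ := hp
      exact num_lt eS eA pl x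
    · simp at hp
  · rw [hQ, hA]
    intro q hq a ha b hb
    rw [theTab_d2 _ _ _ _ _ _ ha hb, theTab_d1 _ _ _ _ _ _ ha]
    by_cases h : q < N
    · rw [theTab_d0_lt _ _ _ _ _ _ h, if_pos h, if_pos h]
      unfold D0 D1 D2
      cases act (decS eS q) with
      | inl p => simp
      | inr f =>
        cases hf : f (decS eA a) with
        | inl p => simp [hf]
        | inr g => simp [hf]
    · obtain ⟨i, rfl⟩ := Nat.exists_eq_add_of_le (not_lt.1 h)
      rw [theTab_d0_ge _ _ _ _ _ _ i (by omega)]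
      simp

def numC (c : S × List A) : ℕ × List ℕ := ((eS c.1 : ℕ), c.2.map fun a => (eA a : ℕ))

theorem theTab_step (c : S × List A) (x : ℕ × List ℕ) :
    (theTab act eS eA d s0 pl).Step (numC eS eA c) x ↔
      ∃ c', astep act c = some c' ∧ x = numC eS eA c' := by
  obtain ⟨s, w⟩ := c
  have h0 := theTab_d0_lt act eS eA d s0 pl (eS s).2
  have h1 := fun a : A => theTab_d1 act eS eA d s0 pl (q := eS s) (eA a).2
  have h2 := fun a b : A => theTab_d2 act eS eA d s0 pl (q := eS s) (eA a).2 (eA b).2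
  simp only [decS_num, Fin.is_lt, if_true] at h0 h1 h2
  simp only [D0] at h0
  simp only [D1] at h1
  simp only [D2] at h2
  constructor
  · intro h
    generalize hy : numC eS eA (s, w) = y at h
    cases h with
    | @step0 q u q' c e0 =>
      simp only [numC, Prod.mk.injEq] at hy
      obtain ⟨rfl, rfl⟩ := hy
      cases ha : act s with
      | inl p =>
        rw [h0, ha] at e0
        simp only [Option.map_some, Option.some.injEq, num, Prod.mk.injEq] at e0
        obtain ⟨rfl, rfl⟩ := e0
        exact ⟨(p.1, w ++ [p.2]), by simp [astep, ha], by simp [numC]⟩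
      | inr f => rw [h0, ha] at e0; simp at e0
    | @step1 q a u q' c e0 e1 =>
      simp only [numC, Prod.mk.injEq] at hy
      obtain ⟨rfl, hy⟩ := hy
      obtain ⟨a, w, rfl, rfl, rfl⟩ := List.map_eq_cons_iff.1 hy
      cases ha : act s with
      | inl p => rw [h0, ha] at e0; simp at e0
      | inr f =>
        cases hf : f a with
        | inl p =>
          rw [h1, ha] at e1
          simp only [hf, Option.map_some, Option.some.injEq, num, Prod.mk.injEq] at e1
          obtain ⟨rfl, rfl⟩ := e1
          exact ⟨(p.1, w ++ [p.2]), by simp [astep, ha, hf], by simp [numC]⟩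
        | inr g => rw [h1, ha] at e1; simp [hf] at e1
    | @step2 q a b u q' c e0 e1 e2 =>
      simp only [numC, Prod.mk.injEq] at hy
      obtain ⟨rfl, hy⟩ := hy
      obtain ⟨a, w, rfl, rfl, hy2⟩ := List.map_eq_cons_iff.1 hy
      obtain ⟨b, w, rfl, rfl, rfl⟩ := List.map_eq_cons_iff.1 hy2
      cases ha : act s with
      | inl p => rw [h0, ha] at e0; simp at e0
      | inr f =>
        cases hf : f a with
        | inl p => rw [h1, ha] at e1; simp [hf] at e1
        | inr g =>
          rw [h2, ha] at e2
          simp only [hf, Option.map_some, Option.some.injEq, num, Prod.mk.injEq] at e2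
          obtain ⟨rfl, rfl⟩ := e2
          exact ⟨((g b).1, w ++ [(g b).2]), by simp [astep, ha, hf], by simp [numC]⟩
  · rintro ⟨c', hc, rfl⟩
    cases ha : act s with
    | inl p =>
      simp only [astep, ha, Option.some.injEq] at hc
      subst hc
      simp only [numC, List.map_append, List.map_cons, List.map_nil]
      exact .step0 (by rw [h0, ha]; rfl)
    | inr f =>
      cases w with
      | nil => simp [astep, ha] at hc
      | cons a w =>
        cases hf : f a with
        | inl p =>
          simp only [astep, ha, hf, Option.some.injEq] at hc
          subst hc
          simp only [numC, List.map_append, List.map_cons, List.map_nil]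
          exact .step1 (by rw [h0, ha]; rfl) (by rw [h1, ha]; simp [hf, num])
        | inr g =>
          cases w with
          | nil => simp [astep, ha, hf] at hc
          | cons b w =>
            simp only [astep, ha, hf, Option.some.injEq] at hc
            subst hc
            simp only [numC, List.map_append, List.map_cons, List.map_nil]
            exact .step2 (by rw [h0, ha]; rfl) (by rw [h1, ha]; simp [hf])
              (by rw [h2, ha]; simp [hf, num])

/-- Termination from an arbitrary configuration. -/
def TermFrom (T : QMTable) (c : ℕ × List ℕ) : Prop :=
  ∃ cfg, Relation.ReflTransGen T.Step c cfg ∧ ∀ c', ¬ T.Step cfg c'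

theorem theTab_termFrom (c : S × List A) :
    TermFrom (theTab act eS eA d s0 pl) (numC eS eA c) ↔ (eval (astep act) c).Dom := by
  constructor
  · rintro ⟨cfg, h, hn⟩
    generalize hy : numC eS eA c = y at h
    induction h using Relation.ReflTransGen.head_induction_on generalizing c with
    | refl =>
      refine Part.dom_iff_mem.2 ⟨c, mem_eval.2 ⟨.refl, ?_⟩⟩
      cases h : astep act c with
      | none => rfl
      | some c' =>
        subst hy
        exact absurd ((theTab_step act eS eA d s0 pl c _).2 ⟨c', h, rfl⟩) (hn _)
    | head h1 h2 ih =>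
      subst hy
      obtain ⟨c', h, rfl⟩ := (theTab_step act eS eA d s0 pl c _).1 h1
      rw [reaches_eval (Relation.ReflTransGen.single h)]
      exact ih c' rfl
  · intro h
    obtain ⟨b, hb⟩ := Part.dom_iff_mem.1 h
    obtain ⟨hr, hn⟩ := mem_eval.1 hb
    refine ⟨numC eS eA b, ?_, ?_⟩
    · exact Relation.ReflTransGen.lift (numC eS eA)
        (fun x y hxy => (theTab_step act eS eA d s0 pl x _).2 ⟨y, hxy, rfl⟩) _ _ hr
    · intro c' hc
      obtain ⟨c'', h, _⟩ := (theTab_step act eS eA d s0 pl b _).1 hc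
      rw [hn] at h
      cases h

theorem theTab_prologue (j : ℕ) (hj : j ≤ pl.length) (w : List A) :
    TermFrom (theTab act eS eA d s0 pl) (pst N (eS s0) j, w.map fun a => (eA a : ℕ)) ↔
      TermFrom (theTab act eS eA d s0 pl) (numC eS eA (s0, w ++ (pl.take j).reverse)) := by
  induction j generalizing w with
  | zero => simp [pst, numC]
  | succ j ih =>
    have hd := theTab_d0_ge act eS eA d s0 pl j (by omega)
    have e : pst N (eS s0) (j + 1) = N + j := by simp [pst]
    have ih' := ih (by omega) (w ++ [pl[j]])
    have e2 : w ++ (pl.take (j + 1)).reverse = w ++ [pl[j]] ++ (pl.take j).reverse := by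
      rw [List.take_succ_eq_append_getElem (by omega)]
      simp
    rw [e2, ← ih', e]
    have hst : (theTab act eS eA d s0 pl).Step (N + j, w.map fun a => (eA a : ℕ))
        (pst N (eS s0) j, (w ++ [pl[j]]).map fun a => (eA a : ℕ)) := by
      simp only [List.map_append, List.map_cons, List.map_nil]
      exact .step0 hd
    constructor
    · rintro ⟨cfg, h, hn⟩
      rcases h.cases_head with rfl | ⟨x, h1, h2⟩
      · exact absurd hst (hn _)
      · refine ⟨cfg, ?_, hn⟩
        suffices x = (pst N (eS s0) j, (w ++ [pl[j]]).map fun a => (eA a : ℕ)) by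
          rw [← this]; exact h2
        generalize hy : (N + j, w.map fun a => (eA a : ℕ)) = y at h1
        cases h1 with
        | step0 e0 =>
          simp only [Prod.mk.injEq] at hy
          obtain ⟨rfl, rfl⟩ := hy
          rw [hd] at e0
          simp only [Option.some.injEq, Prod.mk.injEq] at e0
          obtain ⟨rfl, rfl⟩ := e0
          simp
        | step1 e0 e1 =>
          simp only [Prod.mk.injEq] at hy
          obtain ⟨rfl, _⟩ := hy
          rw [hd] at e0; cases e0
        | step2 e0 e1 =>
          simp only [Prod.mk.injEq] at hy
          obtain ⟨rfl, _⟩ := hy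
          rw [hd] at e0; cases e0
    · rintro ⟨cfg, h, hn⟩
      exact ⟨cfg, .head hst h, hn⟩

theorem theTab_terminates :
    (theTab act eS eA d s0 pl).Terminates ↔ (eval (astep act) (s0, d :: pl.reverse)).Dom := by
  rw [← theTab_termFrom act eS eA d s0 pl]
  have := theTab_prologue act eS eA d s0 pl pl.length le_rfl [d]
  simp only [List.take_length, List.singleton_append] at this
  rw [← this]
  simp [QMTable.Terminates, TermFrom, theTab, mkTab]

end table

/-! ### Simulating the stack machine -/

section sim

open Turing Turing.PartrecToTM2 Turing.TM2.Stmt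

abbrev Al := K' ⊕ Γ'

abbrev Sm := TM2.Stmt (fun _ : K' => Γ') Λ' (Option Γ')

abbrev Bs (F : Finset Λ') := {q : Sm // some q ∈ TM2.stmts tr F}

abbrev St (F : Finset Λ') := Option (Bs F × Option Γ') × Option Al

variable (F : Finset Λ')

open scoped Classical in
noncomputable def mk (q : Sm) (v : Option Γ') : Option (Bs F × Option Γ') :=
  if h : some q ∈ TM2.stmts tr F then some (⟨q, h⟩, v) else none

def toLetter : Al → Option Γ'
  | .inl _ => none
  | .inr g => some g

noncomputable def act : St F → Act (St F) Al
  | (none, _) => .inr fun a => .inr fun _ => ((none, none), a)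
  | (some p, some x) => .inl ((some p, none), x)
  | (some (q, v), none) =>
    match q.1 with
    | push k f q' => .inr fun a =>
        if a = .inl k then .inl ((mk F q' v, some (.inr (f v))), a)
        else .inl ((some (q, v), none), a)
    | peek k f q' => .inr fun a =>
        if a = .inl k then .inr fun b => ((mk F q' (f v (toLetter b)), some b), a)
        else .inl ((some (q, v), none), a)
    | pop k f q' => .inr fun a =>
        if a = .inl k then .inr fun b =>
          match b with
          | .inl j => ((mk F q' (f v none), some (.inl j)), a)
          | .inr g => ((mk F q' (f v (some g)), none), a)
        else .inl ((some (q, v), none), a)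
    | load g q' => .inr fun a => .inl ((mk F q' (g v), none), a)
    | branch f q₁ q₂ => .inr fun a => .inl ((mk F (cond (f v) q₁ q₂) v, none), a)
    | goto l => .inr fun a => .inl ((mk F (tr (l v)) v, none), a)
    | TM2.Stmt.halt => .inr fun a => .inr fun _ => ((none, none), a)

/-- The step function, stopped as soon as the halting state is reached. -/
noncomputable def runStep (c : St F × List Al) : Option (St F × List Al) :=
  match c.1.1 with
  | none => none
  | some _ => astep (act F) c

theorem halt_dom (w : List Al) (x : Option Al) : (eval (astep (act F)) ((none, x), w)).Dom := by
  induction h : w.length generalizing w x with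
  | zero =>
    have : w = [] := List.length_eq_zero_iff.1 h
    subst this
    exact Part.dom_iff_mem.2 ⟨_, mem_eval.2 ⟨.refl, by simp [astep, act]⟩⟩
  | succ n ih =>
    match w, h with
    | [a], _ => exact Part.dom_iff_mem.2 ⟨_, mem_eval.2 ⟨.refl, by simp [astep, act]⟩⟩
    | a :: b :: w, h =>
      have e : astep (act F) ((none, x), a :: b :: w) = some ((none, none), w ++ [a]) := by
        simp [astep, act]
      rw [reaches_eval (Relation.ReflTransGen.single e)]
      exact ih _ _ (by simpa using h)

theorem runStep_dom (c : St F × List Al) :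
    (eval (runStep F) c).Dom ↔ (eval (astep (act F)) c).Dom := by
  have key : ∀ b b', runStep F b = some b' → astep (act F) b = some b' := by
    intro b b' h
    unfold runStep at h
    split at h
    · cases h
    · exact h
  constructor
  · intro h
    obtain ⟨b, hb⟩ := Part.dom_iff_mem.1 h
    obtain ⟨hr, hn⟩ := mem_eval.1 hb
    have hr' : Reaches (astep (act F)) c b := Relation.ReflTransGen.mono (fun x y => key x y) _ _ hr
    rw [reaches_eval hr']
    obtain ⟨⟨o, x⟩, w⟩ := b
    cases o with
    | none => exact halt_dom F w x
    | some p =>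
      refine Part.dom_iff_mem.2 ⟨_, mem_eval.2 ⟨.refl, ?_⟩⟩
      simpa [runStep] using hn
  · intro h
    obtain ⟨b, hb⟩ := Part.dom_iff_mem.1 h
    obtain ⟨hr, hn⟩ := mem_eval.1 hb
    clear hb h
    induction hr using Relation.ReflTransGen.head_induction_on with
    | refl =>
      refine Part.dom_iff_mem.2 ⟨_, mem_eval.2 ⟨.refl, ?_⟩⟩
      unfold runStep
      split
      · rfl
      · exact hn
    | @head x y h1 h2 ih =>
      by_cases hx : x.1.1 = none
      · refine Part.dom_iff_mem.2 ⟨_, mem_eval.2 ⟨.refl, ?_⟩⟩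
        simp [runStep, hx]
      · have : runStep F x = some y := by
          unfold runStep
          split
          · contradiction
          · exact h1
        rw [reaches_eval (Relation.ReflTransGen.single this)]
        exact ih

def ks : List K' := [.main, .rev, .aux, .stack]

def enc (S : K' → List Γ') : List Al :=
  ks.flatMap fun k => Sum.inl k :: (S k).map Sum.inr

theorem enc_split (S : K' → List Γ') (k : K') :
    ∃ j P, (Sum.inl k : Al) ∉ (Sum.inl j :: P : List Al) ∧ ∀ L,
      ((Sum.inl k : Al) :: (L.map Sum.inr ++ Sum.inl j :: P)) ~r enc (Function.update S k L) := by
  cases k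
  · refine ⟨.rev, (S .rev).map Sum.inr ++ .inl .aux :: (S .aux).map Sum.inr ++
      .inl .stack :: (S .stack).map Sum.inr, by simp, fun L => ?_⟩
    simpa [enc, ks, Function.update] using List.IsRotated.refl _
  · refine ⟨.aux, (S .aux).map Sum.inr ++ .inl .stack :: (S .stack).map Sum.inr ++
      .inl .main :: (S .main).map Sum.inr, by simp, fun L => ?_⟩
    refine ⟨(L.map Sum.inr ++ .inl .aux :: (S .aux).map Sum.inr ++
      .inl .stack :: (S .stack).map Sum.inr : List Al).length + 1, ?_⟩
    rw [show (Sum.inl K'.rev :: (L.map Sum.inr ++ Sum.inl K'.aux :: ((S .aux).map Sum.inr ++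
      .inl .stack :: (S .stack).map Sum.inr ++ .inl .main :: (S .main).map Sum.inr)) : List Al) =
      (Sum.inl K'.rev :: (L.map Sum.inr ++ .inl .aux :: (S .aux).map Sum.inr ++
      .inl .stack :: (S .stack).map Sum.inr)) ++ (.inl .main :: (S .main).map Sum.inr) by simp,
      ← List.length_cons, List.rotate_append_length_eq]
    simp [enc, ks, Function.update]
  · refine ⟨.stack, (S .stack).map Sum.inr ++ .inl .main :: (S .main).map Sum.inr ++
      .inl .rev :: (S .rev).map Sum.inr, by simp, fun L => ?_⟩
    refine ⟨(L.map Sum.inr ++ .inl .stack :: (S .stack).map Sum.inr : List Al).length + 1, ?_⟩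
    rw [show (Sum.inl K'.aux :: (L.map Sum.inr ++ Sum.inl K'.stack :: ((S .stack).map Sum.inr ++
      .inl .main :: (S .main).map Sum.inr ++ .inl .rev :: (S .rev).map Sum.inr)) : List Al) =
      (Sum.inl K'.aux :: (L.map Sum.inr ++ .inl .stack :: (S .stack).map Sum.inr)) ++
      (.inl .main :: (S .main).map Sum.inr ++ .inl .rev :: (S .rev).map Sum.inr) by simp,
      ← List.length_cons, List.rotate_append_length_eq]
    simp [enc, ks, Function.update]
  · refine ⟨.main, (S .main).map Sum.inr ++ .inl .rev :: (S .rev).map Sum.inr ++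
      .inl .aux :: (S .aux).map Sum.inr, by simp, fun L => ?_⟩
    refine ⟨(L.map Sum.inr : List Al).length + 1, ?_⟩
    rw [show (Sum.inl K'.stack :: (L.map Sum.inr ++ Sum.inl K'.main :: ((S .main).map Sum.inr ++
      .inl .rev :: (S .rev).map Sum.inr ++ .inl .aux :: (S .aux).map Sum.inr)) : List Al) =
      (Sum.inl K'.stack :: L.map Sum.inr) ++ (.inl .main :: (S .main).map Sum.inr ++
      .inl .rev :: (S .rev).map Sum.inr ++ .inl .aux :: (S .aux).map Sum.inr) by simp,
      ← List.length_cons, List.rotate_append_length_eq]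
    simp [enc, ks, Function.update]

theorem rot_unique {α : Type} {k : α} {x y : List α} (hk : k ∉ x) (h : (k :: x) ~r (k :: y)) :
    x = y := by
  obtain ⟨n, hn, h⟩ := List.isRotated_iff_mod.1 h
  rw [List.rotate_eq_drop_append_take hn] at h
  cases n with
  | zero => simpa using h
  | succ n =>
    rw [List.drop_succ_cons] at h
    cases hd : x.drop n with
    | nil =>
      have : x.length ≤ n := List.drop_eq_nil_iff.1 hd
      simpa [hd, List.take_of_length_le this] using h
    | cons a t =>
      rw [hd] at h
      simp only [List.cons_append, List.cons.injEq] at h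
      exact absurd (List.mem_of_mem_drop (a := k) (i := n) (by rw [hd, h.1]; simp)) hk

theorem snoc_rot (a : Al) (w : List Al) : (w ++ [a]) ~r (a :: w) := by
  simpa using (List.isRotated_append (l := w) (l' := [a]))

theorem seek_aux (s : St F) (hs : s.1 ≠ none) (k : K') (f : Al → _) (hact : act F s = .inr f)
    (hf : ∀ a, a ≠ .inl k → f a = .inl (s, a)) (u b : List Al) (hu : (Sum.inl k : Al) ∉ u) :
    Reaches (runStep F) (s, u ++ Sum.inl k :: b) (s, Sum.inl k :: (b ++ u)) := by
  induction u generalizing b with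
  | nil => rw [List.append_nil]; exact Relation.ReflTransGen.refl
  | cons a u ih =>
    simp only [List.mem_cons, not_or] at hu
    have h1 : runStep F (s, (a :: u) ++ Sum.inl k :: b) = some (s, u ++ Sum.inl k :: (b ++ [a])) := by
      unfold runStep
      split
      · contradiction
      · simp [astep, hact, hf a (Ne.symm hu.1)]
    refine Relation.ReflTransGen.head h1 ?_
    have := ih (b ++ [a]) hu.2
    rw [List.append_assoc, List.singleton_append] at this
    exact this

/-- Rotate the queue until the marker of stack `k` is in front. -/
theorem seek (s : St F) (hs : s.1 ≠ none) (k : K') (f : Al → _) (hact : act F s = .inr f)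
    (hf : ∀ a, a ≠ .inl k → f a = .inl (s, a)) (S : K' → List Γ') (w : List Al) (hw : w ~r enc S) :
    ∃ j P, Reaches (runStep F) (s, w)
        (s, Sum.inl k :: ((S k).map Sum.inr ++ Sum.inl j :: P)) ∧
      ∀ L, ((Sum.inl k : Al) :: (L.map Sum.inr ++ Sum.inl j :: P)) ~r enc (Function.update S k L) := by
  obtain ⟨j, P, hk, hP⟩ := enc_split S k
  refine ⟨j, P, ?_, hP⟩
  have h1 := hP (S k)
  rw [Function.update_eq_self] at h1
  have h2 := h1.trans hw.symm
  have hmem : (Sum.inl k : Al) ∈ w := h2.mem_iff.1 (by simp)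
  obtain ⟨u, b, rfl, hu⟩ := List.eq_append_cons_of_mem hmem
  have h3 : (u ++ Sum.inl k :: b) ~r (Sum.inl k :: (b ++ u)) := by
    simpa using (List.isRotated_append (l := u) (l' := Sum.inl k :: b))
  have h4 := rot_unique (by simpa using hk) (h2.trans h3)
  rw [h4]
  exact seek_aux F s hs k f hact hf u b hu

def trc : TM2.Cfg (fun _ : K' => Γ') Λ' (Option Γ') → St F × List Al → Prop
  | ⟨none, _, _⟩, b => b.1 = (none, none)
  | ⟨some l, v, S⟩, b => l ∈ F ∧ b.1 = (mk F (tr l) v, none) ∧ b.2 ~r enc S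

theorem mk_pos {q : Sm} (h : some q ∈ TM2.stmts tr F) (v) :
    mk F q v = some (⟨q, h⟩, v) := by simp [mk, h]

theorem mem_stmts {l : Λ'} (h : l ∈ F) : some (tr l) ∈ TM2.stmts tr F := by
  classical
  unfold TM2.stmts
  exact Finset.some_mem_insertNone.2 (Finset.mem_biUnion.2 ⟨l, h, TM2.stmts₁_self⟩)

theorem enc_two (S : K' → List Γ') (w : List Al) (hw : w ~r enc S) :
    ∃ a b t, w = a :: b :: t := by
  have := hw.perm.length_eq
  simp only [enc, ks] at this
  match w, this with
  | [], h => simp at h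
  | [a], h => simp at h
  | a :: b :: t, _ => exact ⟨a, b, t, rfl⟩

theorem sim_aux [Inhabited Λ'] (hF : ∀ l ∈ F, TM2.SupportsStmt F (tr l)) (q : Sm)
    (hs : TM2.SupportsStmt F q) (hq : some q ∈ TM2.stmts tr F) (v : Option Γ')
    (S : K' → List Γ') (w : List Al) (hw : w ~r enc S) :
    ∃ b, trc F (TM2.stepAux q v S) b ∧ Reaches₁ (runStep F) ((mk F q v, none), w) b := by
  induction q generalizing v S w with
  | push k f q ih =>
    have hq' : some q ∈ TM2.stmts tr F :=
      TM2.stmts_trans (by simp [TM2.stmts₁, TM2.stmts₁_self]) hq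
    rw [mk_pos F hq]
    obtain ⟨j, P, hr, hP⟩ := seek F (some (⟨_, hq⟩, v), none) (by simp) k _ rfl
      (by intro a ha; simp [ha]) S w hw
    obtain ⟨b, hb1, hb2⟩ := ih hs hq' v (Function.update S k (f v :: S k))
      ((S k).map Sum.inr ++ Sum.inl j :: P ++ [Sum.inl k, Sum.inr (f v)]) (by
        refine List.IsRotated.trans ?_ (hP (f v :: S k))
        exact List.isRotated_append (l := (S k).map Sum.inr ++ Sum.inl j :: P)
          (l' := [Sum.inl k, Sum.inr (f v)]))
    refine ⟨b, hb1, Relation.TransGen.trans_right hr 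
      (.head (b := ((mk F q v, some (.inr (f v))), (S k).map Sum.inr ++ Sum.inl j :: P ++ [Sum.inl k]))
        ?_ (.head ?_ hb2))⟩
    · simp [runStep, astep, act]
    · rw [mk_pos F hq']
      simp [runStep, astep, act]
  | peek k f q ih =>
    have hq' : some q ∈ TM2.stmts tr F :=
      TM2.stmts_trans (by simp [TM2.stmts₁, TM2.stmts₁_self]) hq
    rw [mk_pos F hq]
    obtain ⟨j, P, hr, hP⟩ := seek F (some (⟨_, hq⟩, v), none) (by simp) k _ rfl
      (by intro a ha; simp [ha]) S w hw
    have hP := hP (S k)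
    rw [Function.update_eq_self] at hP
    have : ∃ x t, (S k).map Sum.inr ++ Sum.inl j :: P = x :: t ∧ toLetter x = (S k).head? := by
      cases S k with
      | nil => exact ⟨_, _, rfl, rfl⟩
      | cons a l => exact ⟨_, _, rfl, rfl⟩
    obtain ⟨x, t, e, hx⟩ := this
    rw [e] at hr hP
    obtain ⟨b, hb1, hb2⟩ := ih hs hq' (f v (S k).head?) S (t ++ [Sum.inl k, x]) (by
        refine List.IsRotated.trans ?_ hP
        simpa using (List.isRotated_append (l := t) (l' := [Sum.inl k, x])))
    refine ⟨b, hb1, Relation.TransGen.trans_right hr 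
      (.head (b := ((mk F q (f v (S k).head?), some x), t ++ [Sum.inl k]))
        ?_ (.head ?_ hb2))⟩
    · simp [runStep, astep, act, hx]
    · rw [mk_pos F hq']
      simp [runStep, astep, act]
  | pop k f q ih =>
    have hq' : some q ∈ TM2.stmts tr F :=
      TM2.stmts_trans (by simp [TM2.stmts₁, TM2.stmts₁_self]) hq
    rw [mk_pos F hq]
    obtain ⟨j, P, hr, hP⟩ := seek F (some (⟨_, hq⟩, v), none) (by simp) k _ rfl
      (by intro a ha; simp [ha]) S w hw
    have hP := hP (S k).tail
    cases e : S k with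
    | nil =>
      rw [e] at hr hP
      obtain ⟨b, hb1, hb2⟩ := ih hs hq' (f v none) (Function.update S k [])
        (P ++ [Sum.inl k, Sum.inl j]) (by
          refine List.IsRotated.trans ?_ hP
          simpa using (List.isRotated_append (l := P) (l' := [Sum.inl k, Sum.inl j])))
      refine ⟨b, by simpa [e] using hb1, Relation.TransGen.trans_right hr 
        (.head (b := ((mk F q (f v none), some (Sum.inl j)), P ++ [Sum.inl k]))
          ?_ (.head ?_ hb2))⟩
      · simp [runStep, astep, act]
      · rw [mk_pos F hq']
        simp [runStep, astep, act]
    | cons a l =>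
      rw [e] at hr hP
      obtain ⟨b, hb1, hb2⟩ := ih hs hq' (f v (some a)) (Function.update S k l)
        (l.map Sum.inr ++ Sum.inl j :: P ++ [Sum.inl k]) ((snoc_rot _ _).trans hP)
      refine ⟨b, by simpa [e] using hb1, Relation.TransGen.trans_right hr (.head ?_ hb2)⟩
      simp [runStep, astep, act]
  | load g q ih =>
    have hq' : some q ∈ TM2.stmts tr F :=
      TM2.stmts_trans (by simp [TM2.stmts₁, TM2.stmts₁_self]) hq
    rw [mk_pos F hq]
    obtain ⟨x, y, t, rfl⟩ := enc_two S w hw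
    obtain ⟨b, hb1, hb2⟩ := ih hs hq' (g v) S (y :: t ++ [x]) ((snoc_rot _ _).trans hw)
    refine ⟨b, hb1, .head ?_ hb2⟩
    simp [runStep, astep, act]
  | branch f q₁ q₂ ih₁ ih₂ =>
    have hq₁ : some q₁ ∈ TM2.stmts tr F :=
      TM2.stmts_trans (by simp [TM2.stmts₁, TM2.stmts₁_self]) hq
    have hq₂ : some q₂ ∈ TM2.stmts tr F :=
      TM2.stmts_trans (by simp [TM2.stmts₁, TM2.stmts₁_self]) hq
    rw [mk_pos F hq]
    obtain ⟨x, y, t, rfl⟩ := enc_two S w hw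
    cases hf : f v with
    | true =>
      obtain ⟨b, hb1, hb2⟩ := ih₁ hs.1 hq₁ v S (y :: t ++ [x]) ((snoc_rot _ _).trans hw)
      refine ⟨b, by simpa [hf] using hb1, .head ?_ hb2⟩
      simp [runStep, astep, act, hf]
    | false =>
      obtain ⟨b, hb1, hb2⟩ := ih₂ hs.2 hq₂ v S (y :: t ++ [x]) ((snoc_rot _ _).trans hw)
      refine ⟨b, by simpa [hf] using hb1, .head ?_ hb2⟩
      simp [runStep, astep, act, hf]
  | goto l =>
    rw [mk_pos F hq]
    obtain ⟨x, y, t, rfl⟩ := enc_two S w hw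
    refine ⟨((mk F (tr (l v)) v, none), y :: t ++ [x]),
      ⟨hs v, rfl, (snoc_rot _ _).trans hw⟩, .single ?_⟩
    simp [runStep, astep, act]
  | halt =>
    rw [mk_pos F hq]
    obtain ⟨x, y, t, rfl⟩ := enc_two S w hw
    refine ⟨((none, none), t ++ [x]), rfl, .single ?_⟩
    simp [runStep, astep, act]

theorem sim_respects [Inhabited Λ'] (hF : ∀ l ∈ F, TM2.SupportsStmt F (tr l)) :
    Respects (TM2.step tr) (runStep F) (trc F) := by
  rintro ⟨l, v, S⟩ ⟨s, w⟩ h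
  cases l with
  | none =>
    have h : s = (none, none) := h
    simp [TM2.step, runStep, h]
  | some l =>
    obtain ⟨hl, hs, hw⟩ := h
    simp only at hs hw
    subst hs
    exact sim_aux F hF (tr l) (hF l hl) (mem_stmts F hl) v S w hw

theorem sim_dom (hF : ∀ l ∈ F, TM2.SupportsStmt F (tr l)) (l : Λ') (hl : l ∈ F) (v S) :
    (eval (astep (act F)) ((mk F (tr l) v, none), enc S)).Dom ↔
      (eval (TM2.step tr) ⟨some l, v, S⟩).Dom := by
  rw [← runStep_dom]
  exact tr_eval_dom (sim_respects F hF) ⟨hl, rfl, List.IsRotated.refl _⟩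

end sim

/-! ### Computability of the reduction -/

section comp

theorem primrec_pst (N s0 : ℕ) : Primrec (pst N s0) := by
  unfold pst
  exact Primrec.ite (Primrec.eq.comp Primrec.id (Primrec.const 0)) (Primrec.const _)
    (Primrec.nat_sub.comp (Primrec.nat_add.comp (Primrec.const N) Primrec.id) (Primrec.const 1))

theorem primrec_mkTab (N m d s0 : ℕ) (l0 l1 l2 : List (Option (ℕ × ℕ))) :
    Primrec (mkTab N m d s0 l0 l1 l2) := by
  have h0 : Primrec fun pl : List ℕ =>
      l0 ++ (List.range pl.length).map fun i => some (pst N s0 i, pl.getD i 0) := by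
    refine Primrec.list_append.comp (Primrec.const l0) (Primrec.list_map
      (Primrec.list_range.comp Primrec.list_length) ?_)
    exact Primrec.option_some.comp (Primrec.pair ((primrec_pst N s0).comp Primrec.snd)
      ((Primrec.list_getD 0).comp Primrec.fst Primrec.snd))
  have h : Primrec fun pl : List ℕ => (N + pl.length, m, d, pst N s0 pl.length,
      l0 ++ (List.range pl.length).map (fun i => some (pst N s0 i, pl.getD i 0)), l1, l2) :=
    Primrec.pair (Primrec.nat_add.comp (Primrec.const N) Primrec.list_length) <|
    Primrec.pair (Primrec.const m) <| Primrec.pair (Primrec.const d) <|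
    Primrec.pair ((primrec_pst N s0).comp Primrec.list_length) <|
    Primrec.pair h0 <| Primrec.pair (Primrec.const l1) (Primrec.const l2)
  exact (Primrec.of_equiv_symm (e := qmTableEquiv)).comp h

theorem primrec_replicate (l : List ℕ) (c : ℕ) :
    Primrec fun k : ℕ => l ++ List.replicate k c := by
  have h : Primrec fun k : ℕ => l ++ (List.range k).map fun _ => c :=
    Primrec.list_append.comp (Primrec.const l) (Primrec.list_map Primrec.list_range
      (Primrec.const c).to₂)
  exact h.of_eq fun k => by simp [List.map_const']

theorem primrec_two_pow : Primrec fun k : ℕ => 2 ^ k := by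
  have h : Primrec (Nat.rec (motive := fun _ => ℕ) 1 fun _ x => 2 * x) :=
    Primrec.nat_rec₁ 1 (Primrec.nat_mul.comp (Primrec.const 2) Primrec.snd)
  exact h.of_eq fun k => by
    induction k with
    | zero => rfl
    | succ k ih => rw [pow_succ, mul_comm, ← ih]

def lg (n : ℕ) : ℕ := n.findGreatest fun j => 2 ^ j = n

theorem primrec_lg : Primrec lg :=
  Primrec.nat_findGreatest (p := fun n j => 2 ^ j = n) Primrec.id
    (Primrec.eq.comp (primrec_two_pow.comp Primrec.snd) Primrec.fst)

theorem lg_two_pow (k : ℕ) : lg (2 ^ k) = k := by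
  have h : 2 ^ lg (2 ^ k) = 2 ^ k :=
    Nat.findGreatest_spec (P := fun j => 2 ^ j = 2 ^ k) (Nat.lt_two_pow_self (n := k)).le rfl
  exact Nat.pow_right_injective le_rfl h

open Nat.Partrec (Code) in
/-- A program whose halting set on the powers of two is undecidable. -/
theorem exists_hard_code : ∃ c : Turing.ToPartrec.Code,
    ∀ k : ℕ, (c.eval [2 ^ k]).Dom ↔ ((Denumerable.ofNat Code k).eval 0).Dom := by
  have h : Partrec fun n : ℕ => (Denumerable.ofNat Code (lg n)).eval 0 :=
    Code.eval_part.comp ((Computable.ofNat Code).comp primrec_lg.to_comp) (Computable.const 0)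
  obtain ⟨c, hc⟩ := Turing.ToPartrec.Code.exists_code (Nat.Partrec'.part_iff₁.2 h)
  refine ⟨c, fun k => ?_⟩
  have := hc (2 ^ k ::ᵥ List.Vector.nil)
  rw [show (2 ^ k ::ᵥ List.Vector.nil : List.Vector ℕ 1).1 = [2 ^ k] from rfl] at this
  rw [this]
  simp [lg_two_pow]

open Turing.PartrecToTM2 in
theorem trNat_two_pow (k : ℕ) : trNat (2 ^ k) = List.replicate k Γ'.bit0 ++ [Γ'.bit1] := by
  have h : ∀ k : ℕ, ∃ p : PosNum, ((2 ^ k : ℕ) : Num) = Num.pos p ∧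
      trPosNum p = List.replicate k Γ'.bit0 ++ [Γ'.bit1] := by
    intro k
    induction k with
    | zero => exact ⟨.one, by simp; rfl, rfl⟩
    | succ k ih =>
      obtain ⟨p, h1, h2⟩ := ih
      refine ⟨p.bit0, ?_, by simp [trPosNum, h2, List.replicate_succ]⟩
      rw [pow_succ, mul_two, Nat.cast_add, h1]
      exact congrArg Num.pos (PosNum.bit0_of_bit0 p)
  obtain ⟨p, h1, h2⟩ := h k
  rw [trNat, h1, ← h2]
  rfl

open Turing.PartrecToTM2 in
instance : Fintype K' := ⟨⟨ks, by decide⟩, by intro k; cases k <;> decide⟩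

end comp

end QMUndec

open QMUndec Turing Turing.PartrecToTM2

/-- **Undecidability of the halting problem for queue machines.**
There is no algorithm (computable function, with respect to the natural encoding of
queue machines as natural numbers) which, given a queue machine, decides whether it
terminates from its initial configuration `(q1, $)`. -/
theorem queue_machine_halting_undecidable :
    ¬ ∃ f : QMTable → Bool, Computable f ∧
      ∀ T : QMTable, T.Valid → (f T = true ↔ T.Terminates) := by
  rintro ⟨f, hf, hfT⟩
  obtain ⟨c, hc⟩ := exists_hard_code
  set F := codeSupp c Cont'.halt with hFdef
  have hsupp := tr_supports c Cont'.halt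
  have hF : ∀ l ∈ F, TM2.SupportsStmt F (tr l) := hsupp.2
  have hl : trNormal c Cont'.halt ∈ F := hsupp.1
  classical
  have hfin : Finite (Bs F) :=
    Finite.of_injective (fun q : Bs F => (⟨some q.1, q.2⟩ : {x // x ∈ TM2.stmts tr F}))
      (by rintro ⟨a, _⟩ ⟨b, _⟩ h; simpa using h)
  have : Fintype (Bs F) := Fintype.ofFinite _
  let eS := Fintype.equivFin (St F)
  let eA := Fintype.equivFin Al
  let s0 : St F := (mk F (tr (trNormal c Cont'.halt)) none, none)
  let tl : List Al := [.inl .stack, .inl .aux, .inl .rev, .inr Γ'.cons, .inr Γ'.bit1]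
  let T : ℕ → QMTable := fun k =>
    theTab (act F) eS eA (.inl .main) s0 (tl ++ List.replicate k (.inr Γ'.bit0))
  have hT : Computable T := by
    have h := (primrec_mkTab (Fintype.card (St F)) (Fintype.card Al) (eA (.inl .main)) (eS s0) (tab0 (act F) eS eA)
      (tab1 (act F) eS eA) (tab2 (act F) eS eA)).comp
      (primrec_replicate (tl.map fun a => (eA a : ℕ)) (eA (.inr Γ'.bit0)))
    refine Primrec.to_comp (h.of_eq fun k => ?_)
    simp [T, theTab]
  have key : ∀ k, (T k).Terminates ↔ ((Denumerable.ofNat Nat.Partrec.Code k).eval 0).Dom := by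
    intro k
    rw [← hc, theTab_terminates]
    have e : (Sum.inl K'.main :: (tl ++ List.replicate k (Sum.inr Γ'.bit0)).reverse : List Al) =
        enc (K'.elim (trList [2 ^ k]) [] [] []) := by
      simp [enc, ks, trList, trNat_two_pow, tl]
    rw [e, sim_dom F hF _ hl]
    have h2 := tr_eval c [2 ^ k]
    unfold PartrecToTM2.init at h2
    rw [h2]
    simp
  apply ComputablePred.halting_problem 0
  have hcomp : Computable fun c : Nat.Partrec.Code => f (T (Encodable.encode c)) :=
    hf.comp (hT.comp Computable.encode)
  rw [ComputablePred.computable_iff]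
  refine ⟨_, hcomp, ?_⟩
  funext c
  rw [hfT _ (theTab_valid _ _ _ _ _ _), key]
  simp
end

section
/- For every classical queue machine M there exists a queue machine M̄ (in the sense below, with δ0, δ1, δ2) such that M̄ terminates from its initial configuration (q̄1, $̄) if and only if M terminates from its initial configuration (q1, $). -/
/-- A queue machine `M = (Q, A, $, q1, δ0, δ1, δ2)`: a finite set `Q` of states, a finite
alphabet `A` with a chosen symbol `$ ∈ A`, a starting state `q1 ∈ Q`, and three partial
transition functions `δ0, δ1, δ2` that are disjointly defined and jointly total. -/
structure QM : Type 1 where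
  Q : Type
  A : Type
  fintypeQ : Fintype Q
  fintypeA : Fintype A
  dollar : A
  q1 : Q
  d0 : Q → Option (Q × A)
  d1 : Q → A → Option (Q × A)
  d2 : Q → A → A → Option (Q × A)
  /-- for each `q, a, b`, exactly one of `δ0(q)`, `δ1(q,a)`, `δ2(q,a,b)` is defined -/
  exactOne : ∀ q a b,
      ((d0 q).isSome ∧ d1 q a = none ∧ d2 q a b = none) ∨
      (d0 q = none ∧ (d1 q a).isSome ∧ d2 q a b = none) ∨
      (d0 q = none ∧ d1 q a = none ∧ (d2 q a b).isSome)

/-- The step relation on configurations `(q, w) ∈ Q × A*`: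
`(q, w) → (q', w·c)` if `δ0(q) = (q', c)`;
`(q, a·w) → (q', w·c)` if `δ0(q)` is undefined and `δ1(q, a) = (q', c)`;
`(q, a·b·w) → (q', w·c)` if `δ0(q), δ1(q, a)` are undefined and `δ2(q, a, b) = (q', c)`. -/
inductive QM.Step (M : QM) : M.Q × List M.A → M.Q × List M.A → Prop
  | step0 {q w q' c} : M.d0 q = some (q', c) → QM.Step M (q, w) (q', w ++ [c])
  | step1 {q a w q' c} : M.d0 q = none → M.d1 q a = some (q', c) →
      QM.Step M (q, a :: w) (q', w ++ [c])
  | step2 {q a b w q' c} : M.d0 q = none → M.d1 q a = none → M.d2 q a b = some (q', c) →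
      QM.Step M (q, a :: b :: w) (q', w ++ [c])

/-- A configuration with no successor. -/
def QM.Stuck (M : QM) (cfg : M.Q × List M.A) : Prop := ∀ c', ¬ M.Step cfg c'

/-- `M` terminates from the initial configuration `(q1, $)`: some finite sequence of
steps reaches a configuration with no successor. -/
def QM.Terminates (M : QM) : Prop :=
  ∃ cfg, Relation.ReflTransGen M.Step (M.q1, [M.dollar]) cfg ∧ M.Stuck cfg

/-- A classical queue machine `(Q, A, $, q1, δ)` with a total transition function
`δ : Q × A → Q × A*`. -/
structure ClassicalQM : Type 1 where
  Q : Type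
  A : Type
  fintypeQ : Fintype Q
  fintypeA : Fintype A
  dollar : A
  q1 : Q
  delta : Q → A → Q × List A

/-- The step relation of a classical queue machine:
`(q, a·w) → (q', w·u)` whenever `δ(q, a) = (q', u)`. -/
inductive ClassicalQM.Step (M : ClassicalQM) : M.Q × List M.A → M.Q × List M.A → Prop
  | step {q a w} : ClassicalQM.Step M (q, a :: w) ((M.delta q a).1, w ++ (M.delta q a).2)

/-- A classical queue machine terminates from its initial configuration `(q1, $)` if a
finite sequence of steps reaches a configuration with empty queue (which has no successor). -/
def ClassicalQM.Terminates (M : ClassicalQM) : Prop :=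
  ∃ q : M.Q, Relation.ReflTransGen M.Step (M.q1, [M.dollar]) (q, [])

namespace ClassicalQM

/-!
The simulating machine uses the alphabet `Option A`, where `none` is a blank, and states `(q, l)`
where `l` is a list of symbols still to be written.  A state with `l ≠ []` writes the next symbol
(`δ0`).  A state `(q, [])` reading a letter fires the classical transition (`δ1`), writing a blank
if the transition writes the empty word.  Reading a blank it also reads the next symbol (`δ2`):
two blanks are merged into one, and a blank followed by a letter is treated like the letter.
-/

variable (M : ClassicalQM)

/-- The words that may be pending: suffixes of words written by the transition function. -/
def pendingSet : Set (List M.A) :=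
  {l | l = [] ∨ ∃ q a, l <:+ (M.delta q a).2}

lemma pendingSet_finite : M.pendingSet.Finite := by
  have := M.fintypeQ
  have := M.fintypeA
  have h : M.pendingSet ⊆ {[]} ∪ ⋃ q, ⋃ a, {l | l ∈ (M.delta q a).2.tails} := by
    rintro l (h | ⟨q, a, h⟩)
    · exact Or.inl h
    · refine Or.inr ?_
      simp only [Set.mem_iUnion, Set.mem_ofPred_eq, List.mem_tails]
      exact ⟨q, a, h⟩
  refine Set.Finite.subset ?_ h
  refine (Set.finite_singleton _).union ?_
  exact Set.finite_iUnion fun q => Set.finite_iUnion fun a => List.finite_toSet _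

/-- The states of the simulating machine. -/
abbrev SimQ : Type := M.Q × M.pendingSet

/-- Firing the classical transition for `q, a`. -/
def fire (q : M.Q) (a : M.A) : M.SimQ × Option M.A :=
  (((M.delta q a).1, ⟨(M.delta q a).2.tail, Or.inr ⟨q, a, List.tail_suffix _⟩⟩),
    (M.delta q a).2.head?)

/-- `δ0` of the simulating machine. -/
def sim0 : M.SimQ → Option (M.SimQ × Option M.A)
  | (_, ⟨[], _⟩) => none
  | (q, ⟨c :: t, h⟩) => some ((q, ⟨t, by
      rcases h with h | ⟨q, a, h⟩
      · simp at h
      · exact Or.inr ⟨q, a, (List.suffix_cons c t).trans h⟩⟩), some c)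

/-- `δ1` of the simulating machine. -/
def sim1 : M.SimQ → Option M.A → Option (M.SimQ × Option M.A)
  | (q, ⟨[], _⟩), some a => some (M.fire q a)
  | _, _ => none

/-- `δ2` of the simulating machine. -/
def sim2 : M.SimQ → Option M.A → Option M.A → Option (M.SimQ × Option M.A)
  | (q, ⟨[], h⟩), none, none => some ((q, ⟨[], h⟩), none)
  | (q, ⟨[], _⟩), none, some a => some (M.fire q a)
  | _, _, _ => none

/-- The simulating queue machine. -/
noncomputable def sim : QM where
  Q := M.SimQ
  A := Option M.A
  fintypeQ := by
    have := M.fintypeQ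
    have := M.pendingSet_finite.fintype
    exact inferInstance
  fintypeA := by
    have := M.fintypeA
    exact inferInstance
  dollar := some M.dollar
  q1 := (M.q1, ⟨[], Or.inl rfl⟩)
  d0 := M.sim0
  d1 := M.sim1
  d2 := M.sim2
  exactOne := by
    rintro ⟨q, ⟨_ | ⟨c, t⟩, h⟩⟩ (_ | a) (_ | b) <;> simp [sim0, sim1, sim2]

/-- The classical configuration represented by a configuration of the simulating machine. -/
def decode (x : M.SimQ × List (Option M.A)) : M.Q × List M.A :=
  (x.1.1, x.2.reduceOption ++ x.1.2.1)

/-- A measure that decreases in steps that do not simulate a classical step. -/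
def simMeasure (x : M.SimQ × List (Option M.A)) : ℕ :=
  2 * x.1.2.1.length + x.2.length

lemma reduceOption_head_tail (w : List (Option M.A)) (u : List M.A) :
    (w ++ [u.head?]).reduceOption ++ u.tail = w.reduceOption ++ u := by
  cases u <;> simp [List.reduceOption_append]

/-- A step of the simulating machine is a bookkeeping step or simulates a classical step. -/
lemma sim_step (x y : M.sim.Q × List M.sim.A) (h : M.sim.Step x y) :
    (M.decode y = M.decode x ∧ M.simMeasure y < M.simMeasure x) ∨
      M.Step (M.decode x) (M.decode y) := by
  have hfire : ∀ q a h (v w : List (Option M.A)), v.reduceOption = a :: w.reduceOption →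
      M.Step (M.decode ((q, ⟨[], h⟩), v))
        (M.decode ((M.fire q a).1, w ++ [(M.fire q a).2])) := by
    intro q a h v w hv
    simp only [decode, fire, reduceOption_head_tail, hv, List.append_nil]
    exact Step.step
  have hwrite : ∀ (q : M.Q) c t (h : c :: t ∈ M.pendingSet) (h' : t ∈ M.pendingSet)
      (w : List (Option M.A)),
      M.decode ((q, ⟨t, h'⟩), w ++ [some c]) = M.decode ((q, ⟨c :: t, h⟩), w) ∧
      M.simMeasure ((q, ⟨t, h'⟩), w ++ [some c]) < M.simMeasure ((q, ⟨c :: t, h⟩), w) := by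
    intro q c t h h' w
    constructor
    · simp [decode, List.reduceOption_append]
    · simp only [simMeasure, List.length_append, List.length_cons, List.length_nil]
      omega
  have hmerge : ∀ (p : M.SimQ) (w : List (Option M.A)),
      M.decode (p, w ++ [none]) = M.decode (p, none :: none :: w) ∧
      M.simMeasure (p, w ++ [none]) < M.simMeasure (p, none :: none :: w) := by
    intro p w
    constructor
    · simp [decode, List.reduceOption_append]
    · simp [simMeasure]
  cases h with
  | @step0 q w q' c h0 =>
    change List (Option M.A) at w
    obtain ⟨q, ⟨_ | ⟨c, t⟩, hl⟩⟩ := q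
    · exact absurd h0 (by simp [sim, sim0])
    · left
      simp only [sim, sim0, Option.some.injEq] at h0
      obtain ⟨rfl, rfl⟩ := h0
      exact hwrite _ _ _ _ _ _
  | @step1 q a w q' c h0 h1 =>
    change List (Option M.A) at w
    obtain ⟨q, ⟨_ | ⟨c, t⟩, hl⟩⟩ := q
    · right
      rcases a with _ | a
      · exact absurd h1 (by simp [sim, sim1])
      · have h1 : M.fire q a = (q', c) := Option.some.inj h1
        have := hfire q a hl (some a :: w) w (by simp)
        rwa [h1] at this
    · exact absurd h0 (by simp [sim, sim0])
  | @step2 q a b w q' c h0 h1 h2 =>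
    change List (Option M.A) at w
    obtain ⟨q, ⟨_ | ⟨c, t⟩, hl⟩⟩ := q
    · rcases a with _ | a
      · rcases b with _ | b
        · left
          have h2 : ((q, ⟨[], hl⟩), none) = (q', c) := Option.some.inj h2
          obtain ⟨rfl, rfl⟩ := Prod.mk.inj h2
          exact hmerge _ _
        · right
          have h2 : M.fire q b = (q', c) := Option.some.inj h2
          have := hfire q b hl (none :: some b :: w) w (by simp)
          rwa [h2] at this
      · exact absurd h1 (by simp [sim, sim1])
    · exact absurd h0 (by simp [sim, sim0])

/-- A stuck configuration represents a classical configuration with empty queue. -/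
lemma decode_of_stuck (x : M.SimQ × List (Option M.A)) (h : M.sim.Stuck x) :
    (M.decode x).2 = [] := by
  obtain ⟨⟨q, ⟨_ | ⟨c, t⟩, hl⟩⟩, w⟩ := x
  · rcases w with _ | ⟨_ | a, w⟩
    · simp [decode]
    · rcases w with _ | ⟨_ | b, w⟩
      · simp [decode]
      · exact absurd (QM.Step.step2 (M := M.sim) rfl rfl rfl) (h _)
      · exact absurd (QM.Step.step2 (M := M.sim) rfl rfl rfl) (h _)
    · exact absurd (QM.Step.step1 (M := M.sim) rfl rfl) (h _)
  · exact absurd (QM.Step.step0 (M := M.sim) rfl) (h _)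

lemma decode_reach (x y : M.SimQ × List (Option M.A))
    (h : Relation.ReflTransGen M.sim.Step x y) :
    Relation.ReflTransGen M.Step (M.decode x) (M.decode y) := by
  induction h with
  | refl => exact .refl
  | tail _ hs ih =>
    rcases M.sim_step _ _ hs with h | h
    · rw [h.1]; exact ih
    · exact ih.tail h

lemma step_det {x y z : M.Q × List M.A} (h : M.Step x y) (h' : M.Step x z) : y = z := by
  cases h; cases h'; rfl

/-- If the represented configuration terminates, so does the simulating machine. -/
lemma sim_terminates (q : M.Q) (c : M.Q × List M.A)
    (h : Relation.ReflTransGen M.Step c (q, [])) :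
    ∀ n x, M.simMeasure x = n → M.decode x = c →
      ∃ y, Relation.ReflTransGen M.sim.Step x y ∧ M.sim.Stuck y := by
  induction h using Relation.ReflTransGen.head_induction_on with
  | refl =>
    intro n
    induction n using Nat.strong_induction_on with
    | _ n ih =>
      intro x hn hx
      by_cases hs : M.sim.Stuck x
      · exact ⟨x, .refl, hs⟩
      · obtain ⟨y, hy⟩ : ∃ y, M.sim.Step x y := by simpa [QM.Stuck] using hs
        rcases M.sim_step x y hy with ⟨h1, h2⟩ | h
        · obtain ⟨z, hz, hz'⟩ := ih _ (hn ▸ h2) y rfl (h1.trans hx)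
          exact ⟨z, hz.head hy, hz'⟩
        · rw [hx] at h
          cases h
  | head hab _ ihc =>
    intro n
    induction n using Nat.strong_induction_on with
    | _ n ih =>
      intro x hn hx
      by_cases hs : M.sim.Stuck x
      · exact ⟨x, .refl, hs⟩
      · obtain ⟨y, hy⟩ : ∃ y, M.sim.Step x y := by simpa [QM.Stuck] using hs
        rcases M.sim_step x y hy with ⟨h1, h2⟩ | h
        · obtain ⟨z, hz, hz'⟩ := ih _ (hn ▸ h2) y rfl (h1.trans hx)
          exact ⟨z, hz.head hy, hz'⟩
        · rw [hx] at h
          obtain ⟨z, hz, hz'⟩ := ihc _ y rfl (M.step_det h hab)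
          exact ⟨z, hz.head hy, hz'⟩

end ClassicalQM

/-- For every classical queue machine `M` there exists a queue machine `M'` (with
`δ0, δ1, δ2`) that terminates from its initial configuration if and only if `M`
terminates from its initial configuration. -/
theorem classical_to_queue_machine (M : ClassicalQM) :
    ∃ M' : QM, (M'.Terminates ↔ M.Terminates) := by
  have h0 : M.decode (M.sim.q1, [M.sim.dollar]) = (M.q1, [M.dollar]) := by
    simp [ClassicalQM.decode, ClassicalQM.sim]
  refine ⟨M.sim, ?_, ?_⟩
  · rintro ⟨y, hy, hs⟩
    have h1 : Relation.ReflTransGen M.Step (M.q1, [M.dollar]) (M.decode y) :=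
      M.decode_reach _ _ hy
    have h2 := M.decode_of_stuck y hs
    refine ⟨(M.decode y).1, ?_⟩
    have h3 : M.decode y = ((M.decode y).1, []) := Prod.ext rfl h2
    rw [← h3]
    exact h1
  · rintro ⟨q, hq⟩
    exact M.sim_terminates q _ hq _ _ rfl h0
end

section
/- Let λ and λ' be two distributive laws for the same signature Σ and label set A in the stream setting. If for every set X the functions λ_X and λ'_X agree on all elements of Σ*(B^∞X) of the form ι(t) for t ∈ Σ(B^∞X) (i.e., on all terms of depth exactly 1 applied to streams), then λ = λ', i.e., λ_X(u) = λ'_X(u) for every set X and every u ∈ Σ*(B^∞X). -/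
/-- Σ-terms over a signature: `Op` is the set of operation symbols, `ar` the arity. -/
inductive Term (Op : Type) (ar : Op → ℕ) (X : Type) : Type
  | var : X → Term Op ar X
  | op : (o : Op) → (Fin (ar o) → Term Op ar X) → Term Op ar X

namespace Term
variable {Op : Type} {ar : Op → ℕ}

/-- Functorial action of `Σ*` (term substitution of variables). -/
def map {X Y : Type} (f : X → Y) : Term Op ar X → Term Op ar Y
  | var x => var (f x)
  | op o ts => op o fun i => (ts i).map f

/-- Multiplication `μ` of the free monad: flattening of terms of terms. -/
def join {X : Type} : Term Op ar (Term Op ar X) → Term Op ar X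
  | var t => t
  | op o ts => op o fun i => (ts i).join

end Term

/-- Comultiplication `δ` of the cofree comonad on `B X = A × X`:
color each position of a stream with the tail starting there. -/
def sTails {A X : Type} (σ : Stream' (X × A)) : Stream' (Stream' (X × A) × A) :=
  fun n => (σ.drop n, (σ n).2)

/-- The first transition of a stream: its first label together with its second state. -/
def firstTrans {A Z : Type} (s : Stream' (Z × A)) : A × Z := ((s 0).2, (s 1).1)

/-- A distributive law of the free monad `Σ*` over the cofree comonad `B^∞`
for the stream behaviour `B X = A × X`: a natural family
`λ_X : Σ*(B^∞ X) → B^∞(Σ* X)` satisfying the four axioms (i)-(iv). -/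
structure DistLaw (Op : Type) (ar : Op → ℕ) (A : Type) : Type 1 where
  law : ∀ X : Type, Term Op ar (Stream' (X × A)) → Stream' (Term Op ar X × A)
  natural : ∀ (X Y : Type) (f : X → Y) (u : Term Op ar (Stream' (X × A))),
      law Y (u.map (Stream'.map (Prod.map f id))) =
        Stream'.map (Prod.map (Term.map f) id) (law X u)
  /-- (i): on a bare stream, `λ` returns the same stream, states regarded as terms. -/
  ax_unit : ∀ (X : Type) (σ : Stream' (X × A)),
      law X (Term.var σ) = Stream'.map (Prod.map Term.var id) σ
  /-- (ii): the first state of `λ_X u` is `u` with each stream replaced by its first state. -/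
  ax_counit : ∀ (X : Type) (u : Term Op ar (Stream' (X × A))),
      (law X u 0).1 = u.map fun σ => (σ 0).1
  /-- (iii): compositionality with respect to terms. -/
  ax_mult : ∀ (X : Type) (u : Term Op ar (Term Op ar (Stream' (X × A)))),
      law X u.join =
        Stream'.map (Prod.map Term.join id) (law (Term Op ar X) (u.map (law X)))
  /-- (iv): decompositionality with respect to streams (`δΣ* ∘ λ = B^∞λ ∘ λB^∞ ∘ Σ*δ`):
  applying `λ_X` to the n-th state of `λ_X u`, with each variable occurrence replaced by
  the residual input stream starting at it, yields the n-th tail of `λ_X u`. -/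
  ax_comult : ∀ (X : Type) (u : Term Op ar (Stream' (X × A))),
      Stream'.map (Prod.map (law X) id) (law (Stream' (X × A)) (u.map sTails)) =
        sTails (law X u)

/-- Two distributive laws (for the same signature and label set, in the stream setting)
that agree on all elements of `Σ*(B^∞ X)` of the form `ι(t)` for `t ∈ Σ(B^∞ X)` (depth-1
terms applied to streams) are equal: `λ_X(u) = λ'_X(u)` for every set `X` and every `u`. -/
theorem distLaw_eq_of_eq_on_depth_one (Op : Type) (ar : Op → ℕ) (A : Type)
    (lam lam' : DistLaw Op ar A)
    (h : ∀ (X : Type) (o : Op) (v : Fin (ar o) → Stream' (X × A)),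
      lam.law X (Term.op o fun i => Term.var (v i)) =
        lam'.law X (Term.op o fun i => Term.var (v i))) :
    ∀ (X : Type) (u : Term Op ar (Stream' (X × A))), lam.law X u = lam'.law X u := by
  intro X u
  induction u with
  | var σ => rw [lam.ax_unit, lam'.ax_unit]
  | op o ts ih =>
    have e := lam.ax_mult X (Term.op o fun i => Term.var (ts i))
    have e' := lam'.ax_mult X (Term.op o fun i => Term.var (ts i))
    simp only [Term.join, Term.map] at e e'
    rw [e, e', h]
    simp only [ih]
end

section
/- Let λ and λ' be two distributive laws for the same signature Σ and label set A in the stream setting. If for every set X and every u ∈ Σ*(B^∞X) the streams λ_X(u) and λ'_X(u) have the same first transition (the same first label, and the same second state), then λ = λ'. -/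
/-- Two distributive laws (for the same signature and label set, in the stream setting)
such that for every set `X` and every `u ∈ Σ*(B^∞ X)` the streams `λ_X(u)` and `λ'_X(u)`
have the same first transition (the same first label and the same second state) are
equal. -/
theorem distLaw_eq_of_firstTrans_eq (Op : Type) (ar : Op → ℕ) (A : Type)
    (lam lam' : DistLaw Op ar A)
    (h : ∀ (X : Type) (u : Term Op ar (Stream' (X × A))),
      firstTrans (lam.law X u) = firstTrans (lam'.law X u)) :
    ∀ (X : Type) (u : Term Op ar (Stream' (X × A))), lam.law X u = lam'.law X u := by
  intro X u
  have key : ∀ (L : DistLaw Op ar A) (u : Term Op ar (Stream' (X × A))) (n : ℕ),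
      L.law X u (n + 1) = L.law X (L.law (Stream' (X × A)) (u.map sTails) 1).1 n := by
    intro L u n
    have h1 := congrArg Prod.fst (congrFun (L.ax_comult X u) 1)
    exact (congrFun h1 n).symm
  have main : ∀ (n : ℕ) (u : Term Op ar (Stream' (X × A))),
      lam.law X u n = lam'.law X u n := by
    intro n
    induction n with
    | zero =>
      intro u
      refine Prod.ext ?_ (congrArg Prod.fst (h X u))
      rw [lam.ax_counit, lam'.ax_counit]
    | succ n ih =>
      intro u
      have h2 : (lam.law (Stream' (X × A)) (u.map sTails) 1).1 =
          (lam'.law (Stream' (X × A)) (u.map sTails) 1).1 :=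
        congrArg Prod.snd (h (Stream' (X × A)) (u.map sTails))
      rw [key lam, key lam', h2, ih]
  exact funext fun n => main n u
end

section
/- In the stream setting, for every GSOS law ρ (a family of functions ρ_X : Σ(X × (A × X)) → A × Σ* X natural in X) there is exactly one distributive law λ that extends the biGSOS law induced by ρ; that is, there is a unique distributive law λ such that for every set X and every t ∈ Σ(B^∞X), the first transition (first label and second state) of λ_X(ι(t)) equals ρ_X applied to t with each stream σ occurring in t replaced by the pair (first state of σ, (first label of σ, second state of σ)). -/
namespace GsosAux
variable {Op : Type} {ar : Op → ℕ} {A : Type}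

theorem map_map {X Y Z : Type} (f : X → Y) (g : Y → Z) (t : Term Op ar X) :
    (t.map f).map g = t.map (fun x => g (f x)) := by
  induction t with
  | var x => rfl
  | op o ts ih => simp only [Term.map, ih]

theorem map_join {X Y : Type} (f : X → Y) (t : Term Op ar (Term Op ar X)) :
    t.join.map f = (t.map (Term.map f)).join := by
  induction t with
  | var x => rfl
  | op o ts ih => simp only [Term.map, Term.join, ih]

theorem join_join {X : Type} (t : Term Op ar (Term Op ar (Term Op ar X))) :
    t.join.join = (t.map Term.join).join := by
  induction t with
  | var x => rfl
  | op o ts ih => simp only [Term.map, Term.join, ih]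

theorem join_map_var {X : Type} (t : Term Op ar X) :
    (t.map Term.var).join = t := by
  induction t with
  | var x => rfl
  | op o ts ih => simp only [Term.map, Term.join, ih]

/-- Extension of the GSOS law to all terms. -/
def ext (rho : ∀ X : Type, (o : Op) → (Fin (ar o) → X × (A × X)) → A × Term Op ar X)
    {X : Type} : Term Op ar (X × (A × X)) → A × Term Op ar X
  | .var p => (p.2.1, .var p.2.2)
  | .op o ts =>
    ((rho (Term Op ar X) o (fun i => ((ts i).map Prod.fst, ext rho (ts i)))).1,
     (rho (Term Op ar X) o (fun i => ((ts i).map Prod.fst, ext rho (ts i)))).2.join)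

/-- Naturality of a GSOS law. -/
def NatLaw (rho : ∀ X : Type, (o : Op) → (Fin (ar o) → X × (A × X)) → A × Term Op ar X) : Prop :=
  ∀ (X Y : Type) (f : X → Y) (o : Op) (w : Fin (ar o) → X × (A × X)),
      rho Y o (fun i => (f (w i).1, ((w i).2.1, f (w i).2.2))) =
        ((rho X o w).1, Term.map f (rho X o w).2)

variable {rho : ∀ X : Type, (o : Op) → (Fin (ar o) → X × (A × X)) → A × Term Op ar X}

theorem ext_nat (hn : NatLaw rho) {X Y : Type} (f : X → Y) (t : Term Op ar (X × (A × X))) :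
    ext rho (t.map (fun p => (f p.1, (p.2.1, f p.2.2)))) =
      ((ext rho t).1, (ext rho t).2.map f) := by
  induction t with
  | var x => rfl
  | op o ts ih =>
    have h := hn _ _ (Term.map f) o (fun i => ((ts i).map Prod.fst, ext rho (ts i)))
    simp only [Term.map, ext, ih, map_map, map_join] at h ⊢
    rw [h]

theorem ext_join (hn : NatLaw rho) {X : Type} (t : Term Op ar (Term Op ar (X × (A × X)))) :
    ext rho t.join =
      ((ext rho (t.map (fun s => (s.map Prod.fst, ext rho s)))).1,
       (ext rho (t.map (fun s => (s.map Prod.fst, ext rho s)))).2.join) := by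
  induction t with
  | var x => rfl
  | op o ts ih =>
    have h := hn _ _ Term.join o (fun i => (((ts i).map (fun s => (s.map Prod.fst, ext rho s))).map
      Prod.fst, ext rho ((ts i).map (fun s => (s.map Prod.fst, ext rho s)))))
    simp only [Term.map, Term.join, ext, ih, map_map, map_join, join_join] at h ⊢
    rw [h]

/-- Decomposition of a stream. -/
def dec {X : Type} (σ : Stream' (X × A)) : Stream' (X × A) × (A × Stream' (X × A)) :=
  (σ, ((σ 0).2, σ.drop 1))

/-- One step on terms of streams. -/
def st (rho : ∀ X : Type, (o : Op) → (Fin (ar o) → X × (A × X)) → A × Term Op ar X)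
    {X : Type} (u : Term Op ar (Stream' (X × A))) : A × Term Op ar (Stream' (X × A)) :=
  ext rho (u.map dec)

/-- The law. -/
def lw (rho : ∀ X : Type, (o : Op) → (Fin (ar o) → X × (A × X)) → A × Term Op ar X)
    {X : Type} : Term Op ar (Stream' (X × A)) → ℕ → Term Op ar X × A
  | u, 0 => (u.map (fun σ => (σ 0).1), (st rho u).1)
  | u, n + 1 => lw rho (st rho u).2 n

/-- The law, as a stream. -/
def ls (rho : ∀ X : Type, (o : Op) → (Fin (ar o) → X × (A × X)) → A × Term Op ar X)
    {X : Type} (u : Term Op ar (Stream' (X × A))) : Stream' (Term Op ar X × A) := lw rho u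

theorem st_map (hn : NatLaw rho) {X Y : Type} (f : Stream' (X × A) → Stream' (Y × A))
    (hf : ∀ σ, dec (f σ) = (f σ, ((σ 0).2, f (σ.drop 1)))) (u : Term Op ar (Stream' (X × A))) :
    st rho (u.map f) = ((st rho u).1, (st rho u).2.map f) := by
  have h := ext_nat hn f (u.map dec)
  rw [map_map] at h
  unfold st
  rw [map_map, ← h, show (fun x => dec (f x)) = _ from funext hf]
  rfl

theorem lw_natural (hn : NatLaw rho) {X Y : Type} (f : X → Y) (n : ℕ) :
    ∀ u : Term Op ar (Stream' (X × A)),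
    lw rho (u.map (Stream'.map (Prod.map f id))) n =
      Prod.map (Term.map f) id (lw rho u n) := by
  have hs := fun u => st_map (rho := rho) (X := X) hn (Stream'.map (Prod.map f id))
    (fun σ => rfl) u
  induction n with
  | zero =>
    intro u
    simp only [lw, hs, map_map, Prod.map]
    rfl
  | succ n ih =>
    intro u
    simp only [lw, hs, ih]

theorem lw_unit {X : Type} (n : ℕ) : ∀ σ : Stream' (X × A),
    lw rho (Term.var σ) n = Prod.map Term.var id (σ n) := by
  induction n with
  | zero => intro σ; rfl
  | succ n ih =>
    intro σ
    exact ih (σ.drop 1)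

theorem lw_mult (hn : NatLaw rho) {X : Type} (n : ℕ) :
    ∀ u : Term Op ar (Term Op ar (Stream' (X × A))),
    lw rho u.join n = Prod.map Term.join id
      (lw rho (u.map (ls rho)) n) := by
  have h1 : ∀ u : Term Op ar (Term Op ar (Stream' (X × A))), st rho u.join =
      ((ext rho (u.map (fun s => (s, st rho s)))).1,
       (ext rho (u.map (fun s => (s, st rho s)))).2.join) := by
    intro u
    have h := ext_join hn (u.map (Term.map dec))
    rw [← map_join] at h
    have e : ∀ s : Term Op ar (Stream' (X × A)), s.map (fun x => (dec x).1) = s := by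
      intro s
      induction s with
      | var x => rfl
      | op o ts ih => simp only [Term.map, ih]
    simp only [map_map, e] at h
    exact h
  have h2 : ∀ u : Term Op ar (Term Op ar (Stream' (X × A))),
      st rho (u.map (ls rho)) =
      ((ext rho (u.map (fun s => (s, st rho s)))).1,
       (ext rho (u.map (fun s => (s, st rho s)))).2.map
        (ls rho)) := by
    intro u
    rw [← ext_nat hn, map_map, st, map_map]
    rfl
  induction n with
  | zero =>
    intro u
    simp only [lw, h1, h2, map_map, map_join, Prod.map]
    rfl
  | succ n ih =>
    intro u
    simp only [lw, h1, h2, ih]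

theorem lw_comult (hn : NatLaw rho) {X : Type} (n : ℕ) :
    ∀ u : Term Op ar (Stream' (X × A)),
    Prod.map (ls rho) id
      (lw rho (u.map sTails) n) =
    sTails (lw rho u : Stream' (Term Op ar X × A)) n := by
  have hs := fun u => st_map (rho := rho) (X := X) hn sTails
    (fun σ => by
      simp only [dec, sTails, Prod.mk.injEq, true_and]
      funext k
      show (σ.drop (k + 1), (σ (k+1)).2) = ((σ.drop 1).drop k, (σ (k+1)).2)
      rw [Stream'.drop_drop, Nat.add_comm]) u
  induction n with
  | zero =>
    intro u
    simp only [lw, hs, map_map, Prod.map]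
    have e : u.map (fun x => (sTails x 0).1) = u := by
      induction u with
      | var x => rfl
      | op o ts ih => simp only [Term.map, ih]
    rw [e]
    rfl
  | succ n ih =>
    intro u
    simp only [lw, hs, ih]
    rfl

/-- The distributive law induced by a GSOS law. -/
def distLaw (hn : NatLaw rho) : DistLaw Op ar A where
  law _ u := ls rho u
  natural X Y f u := funext fun n => lw_natural hn f n u
  ax_unit X σ := funext fun n => lw_unit n σ
  ax_counit X u := rfl
  ax_mult X u := funext fun n => lw_mult hn n u
  ax_comult X u := funext fun n => lw_comult hn n u

theorem ext_st (hn : NatLaw rho) {X : Type} (u : Term Op ar (Stream' (X × A))) :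
    ext rho (u.map (fun σ => ((σ 0).1, ((σ 0).2, (σ 1).1)))) =
      ((st rho u).1, (st rho u).2.map (fun σ => (σ 0).1)) := by
  rw [st, ← ext_nat hn, map_map]
  rfl

theorem first_eq (lam : DistLaw Op ar A)
    (h : ∀ (X : Type) (o : Op) (v : Fin (ar o) → Stream' (X × A)),
        firstTrans (lam.law X (Term.op o fun i => Term.var (v i))) =
          rho X o fun i => ((v i 0).1, ((v i 0).2, (v i 1).1)))
    {X : Type} (u : Term Op ar (Stream' (X × A))) :
    firstTrans (lam.law X u) =
      ext rho (u.map (fun σ => ((σ 0).1, ((σ 0).2, (σ 1).1)))) := by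
  induction u with
  | var σ => rw [lam.ax_unit]; rfl
  | op o ts ih =>
    have hm := lam.ax_mult X (Term.op o (fun i => Term.var (ts i)))
    have hh := h _ o (fun i => lam.law X (ts i))
    simp only [Term.join, Term.map] at hm
    have key : (fun i => (((lam.law X (ts i)) 0).1, (((lam.law X (ts i)) 0).2,
        ((lam.law X (ts i)) 1).1))) = fun i =>
        (((ts i).map (fun σ => ((σ 0).1, ((σ 0).2, (σ 1).1)))).map Prod.fst,
          ext rho ((ts i).map (fun σ => ((σ 0).1, ((σ 0).2, (σ 1).1))))) := by
      funext i
      rw [← ih, lam.ax_counit, map_map]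
      rfl
    rw [key] at hh
    rw [hm]
    simp only [Term.map, ext]
    rw [← hh]
    rfl

theorem law_eq (hn : NatLaw rho) (lam : DistLaw Op ar A)
    (h : ∀ (X : Type) (o : Op) (v : Fin (ar o) → Stream' (X × A)),
        firstTrans (lam.law X (Term.op o fun i => Term.var (v i))) =
          rho X o fun i => ((v i 0).1, ((v i 0).2, (v i 1).1)))
    {X : Type} (n : ℕ) : ∀ (u : Term Op ar (Stream' (X × A))),
    lam.law X u n = lw rho u n := by
  induction n with
  | zero =>
    intro u
    have h1 := congrArg Prod.fst ((first_eq lam h u).trans (ext_st hn u))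
    exact Prod.ext (lam.ax_counit X u) h1
  | succ n ih =>
    intro u
    have h1 := congrArg Prod.snd (first_eq lam h (u.map sTails))
    rw [map_map] at h1
    have h2 : ((lam.law _ (u.map sTails)) 1).1 = (st rho u).2 := h1
    have h3 := congrFun (lam.ax_comult X u) 1
    have h4 : lam.law X ((lam.law _ (u.map sTails)) 1).1 = (lam.law X u).drop 1 :=
      congrArg Prod.fst h3
    rw [h2] at h4
    have h5 := congrFun h4 n
    rw [ih] at h5
    exact h5.symm

end GsosAux

/-- **GSOS laws induce unique distributive laws** (stream setting). For every GSOS law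
`ρ_X : Σ(X × (A × X)) → A × Σ* X` (natural in `X`), there is exactly one distributive
law `λ` extending the biGSOS law induced by `ρ`: for every set `X` and every
`t ∈ Σ(B^∞ X)`, the first transition of `λ_X(ι(t))` equals `ρ_X` applied to `t` with
each stream `σ` replaced by the pair `(first state of σ, (first label of σ, second
state of σ))`. -/
theorem gsos_unique_distLaw (Op : Type) (ar : Op → ℕ) (A : Type)
    (rho : ∀ X : Type, (o : Op) → (Fin (ar o) → X × (A × X)) → A × Term Op ar X)
    (hnat : ∀ (X Y : Type) (f : X → Y) (o : Op) (w : Fin (ar o) → X × (A × X)),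
      rho Y o (fun i => (f (w i).1, ((w i).2.1, f (w i).2.2))) =
        ((rho X o w).1, Term.map f (rho X o w).2)) :
    ∃! lam : DistLaw Op ar A,
      ∀ (X : Type) (o : Op) (v : Fin (ar o) → Stream' (X × A)),
        firstTrans (lam.law X (Term.op o fun i => Term.var (v i))) =
          rho X o fun i => ((v i 0).1, ((v i 0).2, (v i 1).1)) := by
  have hn : GsosAux.NatLaw rho := hnat
  refine ⟨GsosAux.distLaw hn, ?_, ?_⟩
  · intro X o v
    have h := GsosAux.ext_st hn (Term.op o fun i => Term.var (v i))
    refine Eq.trans h.symm ?_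
    have h2 := hn X (Term Op ar X) Term.var o (fun i => ((v i 0).1, ((v i 0).2, (v i 1).1)))
    simp only [Term.map, GsosAux.ext]
    rw [h2]
    simp only [GsosAux.join_map_var]
  · intro lam h
    have e : lam.law = (GsosAux.distLaw hn).law := by
      funext X u n
      exact GsosAux.law_eq hn lam h n u
    cases lam
    simp only at e
    subst e
    rfl
end

section
/- In the stream setting, for every coGSOS law ρ (a family of functions ρ_X : Σ(B^∞X) → A × (X + Σ X) natural in X) there is exactly one distributive law λ that extends the biGSOS law induced by ρ; that is, there is a unique distributive law λ such that for every set X and every t ∈ Σ(B^∞X), the first transition (first label and second state) of λ_X(ι(t)) equals ρ_X(t) with the second component mapped into Σ* X (a variable x ∈ X becoming the term x via η, and a depth-1 term in Σ X becoming a term via ι). -/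
/-- The embedding `[η, ι] : X + Σ X → Σ* X` of variables and depth-1 terms into terms. -/
def flatEmbed {Op : Type} {ar : Op → ℕ} {X : Type} :
    X ⊕ ((o : Op) × (Fin (ar o) → X)) → Term Op ar X :=
  Sum.elim Term.var fun p => Term.op p.1 fun i => Term.var (p.2 i)

namespace CoGSOS

/-- depth at most one terms -/
abbrev F (Op : Type) (ar : Op → ℕ) (X : Type) : Type := X ⊕ ((o : Op) × (Fin (ar o) → X))

/-- functorial action of F -/
def fmap {Op : Type} {ar : Op → ℕ} {X Y : Type} (f : X → Y) : F Op ar X → F Op ar Y :=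
  Sum.map f (fun p => ⟨p.1, fun i => f (p.2 i)⟩)

section terms
variable {Op : Type} {ar : Op → ℕ}

theorem fmap_fmap {X Y Z : Type} (f : X → Y) (g : Y → Z) (c : F Op ar X) :
    fmap g (fmap f c) = fmap (fun x => g (f x)) c := by
  rcases c with c | c <;> rfl

theorem fmap_id' {X : Type} (c : F Op ar X) : fmap (fun x => x) c = c := by
  rcases c with c | c <;> rfl

theorem tmap_tmap {X Y Z : Type} (f : X → Y) (g : Y → Z) (t : Term Op ar X) :
    (t.map f).map g = t.map (fun x => g (f x)) := by
  induction t with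
  | var x => rfl
  | op o ts ih => simp only [Term.map]; congr 1; funext i; exact ih i

theorem flat_fmap {X Y : Type} (f : X → Y) (c : F Op ar X) :
    flatEmbed (fmap f c) = (flatEmbed c).map f := by
  rcases c with c | c <;> rfl

theorem join_map_map {X Y : Type} (f : X → Y) (t : Term Op ar (Term Op ar X)) :
    (t.map (Term.map f)).join = t.join.map f := by
  induction t with
  | var x => rfl
  | op o ts ih => simp only [Term.map, Term.join]; congr 1; funext i; exact ih i

theorem join_map_join {X : Type} (t : Term Op ar (Term Op ar (Term Op ar X))) :
    (t.map Term.join).join = t.join.join := by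
  induction t with
  | var x => rfl
  | op o ts ih => simp only [Term.map, Term.join]; congr 1; funext i; exact ih i

theorem join_map_var {X : Type} (t : Term Op ar X) :
    (t.map Term.var).join = t := by
  induction t with
  | var x => rfl
  | op o ts ih => simp only [Term.map, Term.join]; congr 1; funext i; exact ih i

end terms

/-- map on states of a stream -/
abbrev smap {A X Y : Type} (f : X → Y) (s : Stream' (X × A)) : Stream' (Y × A) :=
  Stream'.map (Prod.map f id) s

theorem smap_smap {A X Y Z : Type} (f : X → Y) (g : Y → Z) (s : Stream' (X × A)) :
    smap g (smap f s) = smap (fun x => g (f x)) s := rfl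

theorem sTails_smap {A X Y : Type} (f : X → Y) (s : Stream' (X × A)) :
    sTails (smap f s) = smap (smap f) (sTails s) := rfl

theorem sTails_sTails {A X : Type} (s : Stream' (X × A)) :
    sTails (sTails s) = smap sTails (sTails s) := by
  funext n
  refine Prod.ext ?_ rfl
  funext m
  refine Prod.ext ?_ rfl
  funext k
  change s _ = s _
  congr 1
  show k + (m + n) = k + m + n
  omega

section
variable {Op : Type} {ar : Op → ℕ} {A : Type}
    (rho : ∀ X : Type, (o : Op) → (Fin (ar o) → Stream' (X × A)) →
      A × (X ⊕ ((o' : Op) × (Fin (ar o') → X))))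

/-- one step of a depth one configuration -/
def step (X : Type) : F Op ar (Stream' (X × A)) → A × F Op ar (Stream' (X × A))
  | .inl s => ((s 0).2, .inl (s.drop 1))
  | .inr p => rho _ p.1 (fun i => sTails (p.2 i))

/-- iterated step -/
def iter (X : Type) : ℕ → F Op ar (Stream' (X × A)) → F Op ar (Stream' (X × A))
  | 0, c => c
  | n + 1, c => iter X n (step rho X c).2

/-- depth one law -/
def L (X : Type) (c : F Op ar (Stream' (X × A))) : Stream' (F Op ar X × A) :=
  fun n => (fmap (fun s => (s 0).1) (iter rho X n c), (step rho X (iter rho X n c)).1)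

theorem iter_add (X : Type) (m n : ℕ) (c : F Op ar (Stream' (X × A))) :
    iter rho X (m + n) c = iter rho X m (iter rho X n c) := by
  induction n generalizing c with
  | zero => rfl
  | succ n ih => exact ih _

/-- the full law -/
def full (X : Type) : Term Op ar (Stream' (X × A)) → Stream' (Term Op ar X × A)
  | .var s => smap Term.var s
  | .op o ts => smap (fun c => (flatEmbed c).join)
      (L rho (Term Op ar X) (.inr ⟨o, fun i => full X (ts i)⟩))

/-- naturality -/
def IsNat : Prop := ∀ (X Y : Type) (f : X → Y) (o : Op) (v : Fin (ar o) → Stream' (X × A)),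
      rho Y o (fun i => Stream'.map (Prod.map f id) (v i)) =
        ((rho X o v).1,
          Sum.map f (fun p => ⟨p.1, fun i => f (p.2 i)⟩) (rho X o v).2)

variable {rho}

theorem step_map (hnat : IsNat rho) {X Y : Type} (f : X → Y) (c : F Op ar (Stream' (X × A))) :
    step rho Y (fmap (smap f) c) = ((step rho X c).1, fmap (smap f) (step rho X c).2) := by
  rcases c with s | p
  · rfl
  · exact hnat _ _ (smap f) p.1 (fun i => sTails (p.2 i))

theorem step_tails (hnat : IsNat rho) {X : Type} (c : F Op ar (Stream' (X × A))) :
    step rho _ (fmap sTails c) = ((step rho X c).1, fmap sTails (step rho X c).2) := by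
  rcases c with s | p
  · refine Prod.ext rfl ?_
    refine congrArg Sum.inl ?_
    funext n
    refine Prod.ext ?_ rfl
    funext k
    change s _ = s _
    congr 1
  · have := hnat _ _ sTails p.1 (fun i => sTails (p.2 i))
    simp only [← sTails_sTails] at this
    exact this

theorem iter_map (hnat : IsNat rho) {X Y : Type} (f : X → Y) (n : ℕ)
    (c : F Op ar (Stream' (X × A))) :
    iter rho Y n (fmap (smap f) c) = fmap (smap f) (iter rho X n c) := by
  induction n generalizing c with
  | zero => rfl
  | succ n ih => simp only [iter, step_map hnat, ih]

theorem iter_tails (hnat : IsNat rho) {X : Type} (n : ℕ)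
    (c : F Op ar (Stream' (X × A))) :
    iter rho _ n (fmap sTails c) = fmap sTails (iter rho X n c) := by
  induction n generalizing c with
  | zero => rfl
  | succ n ih => simp only [iter, step_tails hnat, ih]

theorem L_map (hnat : IsNat rho) {X Y : Type} (f : X → Y) (c : F Op ar (Stream' (X × A))) :
    L rho Y (fmap (smap f) c) = smap (fmap f) (L rho X c) := by
  funext n
  refine Prod.ext ?_ ?_
  · change fmap _ (iter rho Y n _) = fmap f (fmap _ _)
    rw [iter_map hnat, fmap_fmap, fmap_fmap]; rfl
  · change (step rho Y (iter rho Y n _)).1 = (step rho X (iter rho X n c)).1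
    rw [iter_map hnat, step_map hnat]

theorem L_comult (hnat : IsNat rho) {X : Type} (c : F Op ar (Stream' (X × A))) :
    smap (L rho X) (L rho _ (fmap sTails c)) = sTails (L rho X c) := by
  funext n
  refine Prod.ext ?_ ?_
  · change L rho X (fmap _ (iter rho _ n _)) = Stream'.drop n (L rho X c)
    rw [iter_tails hnat, fmap_fmap]
    have : fmap (fun x => (sTails x 0).1) (iter rho X n c) = iter rho X n c := fmap_id' _
    rw [this]
    funext m
    change _ = L rho X c (m + n)
    simp only [L, iter_add]
  · change (step rho _ (iter rho _ n _)).1 = (step rho X (iter rho X n c)).1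
    rw [iter_tails hnat, step_tails hnat]

theorem L_inl {X : Type} (s : Stream' (X × A)) : L rho X (.inl s) = smap Sum.inl s := by
  have h : ∀ n (s : Stream' (X × A)), iter rho X n (.inl s) = .inl (s.drop n) := by
    intro n
    induction n with
    | zero => intro s; rfl
    | succ n ih =>
      intro s
      simp only [iter, step, ih]
      rw [Stream'.drop_drop, Nat.add_comm]
  funext n
  simp only [L, h]
  refine Prod.ext ?_ ?_
  · change Sum.inl (s (0 + n)).1 = Sum.inl (s n).1
    rw [Nat.zero_add]
  · change (s (0 + n)).2 = (s n).2
    rw [Nat.zero_add]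

theorem full_flat (hnat : IsNat rho) {X : Type} (c : F Op ar (Stream' (X × A))) :
    full rho X (flatEmbed c) = smap flatEmbed (L rho X c) := by
  rcases c with s | p
  · rw [L_inl]; rfl
  · change smap (fun c => (flatEmbed c).join)
      (L rho (Term Op ar X) (fmap (smap Term.var) (.inr p))) = _
    rw [L_map hnat, smap_smap]
    congr 1
    funext c
    rw [flat_fmap, join_map_var]

theorem full_natural (hnat : IsNat rho) {X Y : Type} (f : X → Y)
    (u : Term Op ar (Stream' (X × A))) :
    full rho Y (u.map (smap f)) = smap (Term.map f) (full rho X u) := by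
  induction u with
  | var s => rfl
  | op o ts ih =>
    simp only [Term.map, full, ih]
    have := L_map hnat (Term.map f) (.inr ⟨o, fun i => full rho X (ts i)⟩)
    refine (congrArg (smap _) this).trans ?_
    rw [smap_smap, smap_smap]
    congr 1
    funext c
    rw [flat_fmap, join_map_map]

theorem full_counit {X : Type} (u : Term Op ar (Stream' (X × A))) :
    (full rho X u 0).1 = u.map fun σ => (σ 0).1 := by
  induction u with
  | var s => rfl
  | op o ts ih =>
    change Term.op o (fun i => (full rho X (ts i) 0).1) = _
    simp only [ih]; rfl

theorem full_mult (hnat : IsNat rho) {X : Type} (u : Term Op ar (Term Op ar (Stream' (X × A)))) :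
    full rho X u.join = smap Term.join (full rho _ (u.map (full rho X))) := by
  induction u with
  | var s => rfl
  | op o ts ih =>
    simp only [Term.map, Term.join, full, ih]
    have := L_map hnat Term.join
      (.inr ⟨o, fun i => full rho (Term Op ar X) ((ts i).map (full rho X))⟩)
    refine (congrArg (smap _) this).trans ?_
    rw [smap_smap, smap_smap]
    congr 1
    funext c
    rw [flat_fmap, join_map_join]

theorem full_comult (hnat : IsNat rho) {X : Type} (u : Term Op ar (Stream' (X × A))) :
    smap (full rho X) (full rho _ (u.map sTails)) = sTails (full rho X u) := by
  induction u with
  | var s => rfl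
  | op o ts ih =>
    have e1 : (fun c : F Op ar (Term Op ar (Stream' (X × A))) =>
        full rho X (flatEmbed c).join) = fun c =>
        smap (fun c => (flatEmbed c).join) (L rho _ (fmap (full rho X) c)) := by
      funext c
      rw [full_mult hnat, ← flat_fmap, full_flat hnat, smap_smap]
    have e2 := L_map hnat (full rho X)
      (.inr ⟨o, fun i => full rho (Stream' (X × A)) ((ts i).map sTails)⟩)
    have e3 : fmap (smap (full rho X))
      (.inr ⟨o, fun i => full rho (Stream' (X × A)) ((ts i).map sTails)⟩ : F Op ar _) =
       fmap sTails (.inr ⟨o, fun i => full rho X (ts i)⟩) := by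
      change (Sum.inr ⟨o, fun i => _⟩ : F Op ar _) = Sum.inr ⟨o, fun i => _⟩
      simp only [ih]
    rw [e3] at e2
    have e4 := L_comult hnat (.inr ⟨o, fun i => full rho X (ts i)⟩)
    rw [e2] at e4
    simp only [Term.map, full]
    rw [smap_smap, e1, sTails_smap, ← e4]
    rfl

/-- the distributive law -/
def dl (hnat : IsNat rho) : DistLaw Op ar A where
  law := full rho
  natural _ _ f u := full_natural hnat f u
  ax_unit _ _ := rfl
  ax_counit _ u := full_counit u
  ax_mult _ u := full_mult hnat u
  ax_comult _ u := full_comult hnat u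

theorem step_head (hnat : IsNat rho) {X : Type} (o : Op) (v : Fin (ar o) → Stream' (X × A)) :
    rho X o v = ((step rho X (.inr ⟨o, v⟩)).1,
      fmap (fun s => (s 0).1) (step rho X (.inr ⟨o, v⟩)).2) := by
  have := hnat _ _ (fun s : Stream' (X × A) => (s 0).1) o (fun i => sTails (v i))
  have e : (fun i => smap (fun s : Stream' (X × A) => (s 0).1) (sTails (v i))) = v := by
    funext i n
    change ((v i (0 + n)).1, (v i n).2) = _
    rw [Nat.zero_add]
  exact (congrArg (rho X o) e).symm.trans this

theorem dl_ext (hnat : IsNat rho) (X : Type) (o : Op) (v : Fin (ar o) → Stream' (X × A)) :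
    firstTrans ((dl hnat).law X (Term.op o fun i => Term.var (v i))) =
          ((rho X o v).1, flatEmbed (rho X o v).2) := by
  have h := full_flat hnat (.inr ⟨o, v⟩)
  change firstTrans (full rho X (flatEmbed (.inr ⟨o, v⟩))) = _
  rw [h, step_head hnat]
  rfl

theorem uniq_flat (lam : DistLaw Op ar A)
    (h : ∀ (X : Type) (o : Op) (v : Fin (ar o) → Stream' (X × A)),
        firstTrans (lam.law X (Term.op o fun i => Term.var (v i))) =
          ((rho X o v).1, flatEmbed (rho X o v).2))
    {X : Type} (c : F Op ar (Stream' (X × A))) :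
    lam.law X (flatEmbed c) = smap flatEmbed (L rho X c) := by
  have key : ∀ c : F Op ar (Stream' (X × A)),
      firstTrans (lam.law _ ((flatEmbed c).map sTails)) =
        ((step rho X c).1, flatEmbed (step rho X c).2) := by
    intro c
    rcases c with s | p
    · change firstTrans (lam.law _ (Term.var (sTails s))) = _
      rw [lam.ax_unit]; rfl
    · exact h _ p.1 (fun i => sTails (p.2 i))
  have label : ∀ c : F Op ar (Stream' (X × A)),
      (lam.law X (flatEmbed c) 0).2 = (step rho X c).1 := by
    intro c
    have h0 := congrFun (lam.ax_comult X (flatEmbed c)) 0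
    have h1 := congrArg Prod.snd h0
    exact h1.symm.trans (congrArg Prod.fst (key c))
  have tl : ∀ c : F Op ar (Stream' (X × A)),
      (lam.law X (flatEmbed c)).drop 1 = lam.law X (flatEmbed (step rho X c).2) := by
    intro c
    have h0 := congrFun (lam.ax_comult X (flatEmbed c)) 1
    have h1 := congrArg Prod.fst h0
    exact h1.symm.trans (congrArg (lam.law X) (congrArg Prod.snd (key c)))
  funext n
  induction n generalizing c with
  | zero =>
    refine Prod.ext ?_ (label c)
    rw [lam.ax_counit, ← flat_fmap]; rfl
  | succ n ih =>
    have := congrFun (tl c) n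
    exact this.trans (ih _)

theorem uniq (hnat : IsNat rho) (lam : DistLaw Op ar A)
    (h : ∀ (X : Type) (o : Op) (v : Fin (ar o) → Stream' (X × A)),
        firstTrans (lam.law X (Term.op o fun i => Term.var (v i))) =
          ((rho X o v).1, flatEmbed (rho X o v).2))
    {X : Type} (u : Term Op ar (Stream' (X × A))) :
    lam.law X u = full rho X u := by
  induction u with
  | var s => exact lam.ax_unit X s
  | op o ts ih =>
    have e := lam.ax_mult X (Term.op o fun i => Term.var (ts i))
    have e' := uniq_flat lam h (.inr ⟨o, fun i => lam.law X (ts i)⟩)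
    refine e.trans ((congrArg (smap Term.join) e').trans ?_)
    simp only [ih]
    rfl

end

end CoGSOS

/-- **coGSOS laws induce unique distributive laws** (stream setting). For every coGSOS
law `ρ_X : Σ(B^∞ X) → A × (X + Σ X)` (natural in `X`), there is exactly one distributive
law `λ` extending the biGSOS law induced by `ρ`: for every set `X` and every
`t ∈ Σ(B^∞ X)`, the first transition of `λ_X(ι(t))` equals `ρ_X(t)` with the second
component mapped into `Σ* X` via `[η, ι]`. -/
theorem cogsos_unique_distLaw (Op : Type) (ar : Op → ℕ) (A : Type)
    (rho : ∀ X : Type, (o : Op) → (Fin (ar o) → Stream' (X × A)) →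
      A × (X ⊕ ((o' : Op) × (Fin (ar o') → X))))
    (hnat : ∀ (X Y : Type) (f : X → Y) (o : Op) (v : Fin (ar o) → Stream' (X × A)),
      rho Y o (fun i => Stream'.map (Prod.map f id) (v i)) =
        ((rho X o v).1,
          Sum.map f (fun p => ⟨p.1, fun i => f (p.2 i)⟩) (rho X o v).2)) :
    ∃! lam : DistLaw Op ar A,
      ∀ (X : Type) (o : Op) (v : Fin (ar o) → Stream' (X × A)),
        firstTrans (lam.law X (Term.op o fun i => Term.var (v i))) =
          ((rho X o v).1, flatEmbed (rho X o v).2) := by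
  refine ⟨CoGSOS.dl hnat, CoGSOS.dl_ext hnat, ?_⟩
  intro lam h
  have e : lam.law = CoGSOS.full rho := by
    funext X u
    exact CoGSOS.uniq hnat lam h u
  obtain ⟨law, _, _, _, _, _⟩ := lam
  subst e
  rfl
end

section
/- Let A = {$, €} be a two-element set of labels, and consider the signature with one constant C and one unary operation symbol q. Let ρ be the biGSOS law defined by: ρ_X(C) = ($, q(C)), and for every stream σ = x0 →a0 x1 →a1 x2 →a2 ⋯ ∈ B^∞X, ρ_X(q(σ)) = (a1, x2) (the target is the variable x2 regarded as a term). Then there exist two distinct distributive laws λ ≠ λ' that both extend ρ; in particular one can choose them so that λ_∅(C) is the stream C →$ q(C) →$ q(C) →$ q(C) →$ ⋯ and λ'_∅(C) is the stream C →$ q(C) →€ q(C) →€ q(C) →€ ⋯ (where ∅ is the empty set of variables). -/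
/-- The signature with one constant `C` (symbol `false`) and one unary operation
symbol `q` (symbol `true`). -/
def cqAr : Bool → ℕ
  | false => 0
  | true => 1

/-- The constant term `C`. -/
def CT (X : Type) : Term Bool cqAr X := Term.op false Fin.elim0

/-- Application of the unary operation symbol `q`. -/
def qT {X : Type} (t : Term Bool cqAr X) : Term Bool cqAr X := Term.op true fun _ => t

theorem cq_ind {X : Type} {P : Term Bool cqAr X → Prop} (hv : ∀ x, P (Term.var x))
    (hC : P (CT X)) (hq : ∀ t, P t → P (qT t)) (t : Term Bool cqAr X) : P t := by
  induction t with
  | var x => exact hv x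
  | op o ts ih =>
    cases o with
    | false =>
      have h : ts = Fin.elim0 := by
        funext i
        exact Fin.elim0 i
      rw [h]
      exact hC
    | true =>
      have h : ts = fun _ => ts (0 : Fin 1) := by
        funext i
        exact congrArg ts (Subsingleton.elim (α := Fin 1) i 0)
      rw [h]
      exact hq _ (ih (0 : Fin 1))

/-- The stream of the constant `C`. -/
def cStream (l : Bool) (X : Type) : Stream' (Term Bool cqAr X × Bool)
  | 0 => (CT X, true)
  | _ + 1 => (qT (CT X), l)

/-- The action of `q` on streams of terms. -/
def qStream {X : Type} (s : Stream' (Term Bool cqAr X × Bool)) : Stream' (Term Bool cqAr X × Bool)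
  | 0 => (qT (s 0).1, (s 1).2)
  | n + 1 => s (n + 2)

/-- The distributive law with looping label `l`. -/
def lawL (l : Bool) (X : Type) :
    Term Bool cqAr (Stream' (X × Bool)) → Stream' (Term Bool cqAr X × Bool)
  | .var σ => Stream'.map (Prod.map Term.var id) σ
  | .op false _ => cStream l X
  | .op true ts => qStream (lawL l X (ts (0 : Fin 1)))

theorem lawL_var (l : Bool) (X : Type) (σ : Stream' (X × Bool)) :
    lawL l X (.var σ) = Stream'.map (Prod.map Term.var id) σ := by
  simp only [lawL]

theorem lawL_C (l : Bool) (X : Type) : lawL l X (CT _) = cStream l X := by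
  simp only [CT, lawL]

theorem lawL_q (l : Bool) (X : Type) (t) : lawL l X (qT t) = qStream (lawL l X t) := by
  simp only [qT, lawL]

theorem map_CT {X Y : Type} (f : X → Y) : (CT X).map f = CT Y := by
  simp only [CT, Term.map]
  congr 1
  funext i
  exact Fin.elim0 i

theorem map_qT {X Y : Type} (f : X → Y) (t : Term Bool cqAr X) :
    (qT t).map f = qT (t.map f) := by
  simp only [qT, Term.map]

theorem join_CT {X : Type} : (CT (Term Bool cqAr X)).join = CT X := by
  simp only [CT, Term.join]
  congr 1
  funext i
  exact Fin.elim0 i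

theorem join_qT {X : Type} (t : Term Bool cqAr (Term Bool cqAr X)) :
    (qT t).join = qT t.join := by
  simp only [qT, Term.join]

theorem map_app {α β : Type} (f : α → β) (s : Stream' α) (n : ℕ) :
    Stream'.map f s n = f (s n) := rfl

theorem map_qStream {X Y : Type} (f : Term Bool cqAr X → Term Bool cqAr Y)
    (hf : ∀ t, f (qT t) = qT (f t)) (s : Stream' (Term Bool cqAr X × Bool)) :
    Stream'.map (Prod.map f id) (qStream s) = qStream (Stream'.map (Prod.map f id) s) := by
  funext n
  cases n with
  | zero => exact Prod.ext (hf _) rfl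
  | succ n => rfl

theorem map_cStream {X Y : Type} (l : Bool) (f : Term Bool cqAr X → Term Bool cqAr Y)
    (hf : ∀ t, f (qT t) = qT (f t)) (hc : f (CT X) = CT Y) :
    Stream'.map (Prod.map f id) (cStream l X) = cStream l Y := by
  funext n
  cases n with
  | zero => exact Prod.ext hc rfl
  | succ n => exact Prod.ext ((hf _).trans (congrArg qT hc)) rfl

theorem map_map_term {X Y Z : Type} (f : X → Y) (g : Y → Z) (t : Term Bool cqAr X) :
    (t.map f).map g = t.map fun x => g (f x) := by
  induction t using cq_ind with
  | hv x => simp only [Term.map]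
  | hC => simp only [map_CT]
  | hq t ih => simp only [map_qT, ih]

theorem lawL_counit (l : Bool) (X : Type) (u : Term Bool cqAr (Stream' (X × Bool))) :
    (lawL l X u 0).1 = u.map fun σ => (σ 0).1 := by
  induction u using cq_ind with
  | hv x => simp only [Term.map, lawL_var]; rfl
  | hC => simp only [map_CT, lawL_C]; rfl
  | hq t ih => rw [map_qT, lawL_q, ← ih]; rfl

theorem lawL_natural (l : Bool) (X Y : Type) (f : X → Y)
    (u : Term Bool cqAr (Stream' (X × Bool))) :
    lawL l Y (u.map (Stream'.map (Prod.map f id))) =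
      Stream'.map (Prod.map (Term.map f) id) (lawL l X u) := by
  induction u using cq_ind with
  | hv x => simp only [Term.map, lawL_var]; rfl
  | hC => rw [map_CT, lawL_C, lawL_C, map_cStream l _ (map_qT f) (map_CT f)]
  | hq t ih => rw [map_qT, lawL_q, lawL_q, map_qStream _ (map_qT f), ih]

theorem lawL_mult (l : Bool) (X : Type)
    (u : Term Bool cqAr (Term Bool cqAr (Stream' (X × Bool)))) :
    lawL l X u.join =
      Stream'.map (Prod.map Term.join id) (lawL l (Term Bool cqAr X) (u.map (lawL l X))) := by
  induction u using cq_ind with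
  | hv x => simp only [Term.map, Term.join, lawL_var]; rfl
  | hC => rw [map_CT, join_CT, lawL_C, lawL_C, map_cStream l _ join_qT join_CT]
  | hq t ih => rw [map_qT, join_qT, lawL_q, lawL_q, map_qStream _ join_qT, ih]

theorem lawL_comult (l : Bool) (X : Type) (u : Term Bool cqAr (Stream' (X × Bool))) :
    Stream'.map (Prod.map (lawL l X) id) (lawL l (Stream' (X × Bool)) (u.map sTails)) =
      sTails (lawL l X u) := by
  induction u using cq_ind with
  | hv x =>
    simp only [Term.map, lawL_var]
    funext n
    exact Prod.ext (lawL_var l X _) rfl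
  | hC =>
    rw [map_CT, lawL_C, lawL_C]
    funext n
    cases n with
    | zero => exact Prod.ext (lawL_C l X) rfl
    | succ n =>
      refine Prod.ext ?_ rfl
      change lawL l X (qT (CT _)) = _
      rw [lawL_q, lawL_C]
      funext m
      cases m <;> rfl
  | hq t ih =>
    rw [map_qT, lawL_q, lawL_q]
    have ih' : ∀ n, (lawL l X (lawL l (Stream' (X × Bool)) (t.map sTails) n).1,
        (lawL l (Stream' (X × Bool)) (t.map sTails) n).2) =
        ((lawL l X t).drop n, (lawL l X t n).2) := fun n => congrFun ih n
    funext n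
    cases n with
    | zero =>
      have h0 := congrArg Prod.fst (ih' 0)
      have h1 := congrArg Prod.snd (ih' 1)
      refine Prod.ext ?_ h1
      change lawL l X (qT _) = qStream (lawL l X t)
      rw [lawL_q]
      exact congrArg qStream h0
    | succ n =>
      refine (ih' (n + 2)).trans ?_
      refine Prod.ext ?_ rfl
      funext m
      rfl

/-- The distributive law with looping label `l`. -/
def distL (l : Bool) : DistLaw Bool cqAr Bool where
  law := lawL l
  natural := lawL_natural l
  ax_unit := lawL_var l
  ax_counit := lawL_counit l
  ax_mult := lawL_mult l
  ax_comult := lawL_comult l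

theorem distL_C (l : Bool) (X : Type) (n : ℕ) : (distL l).law X (CT (Stream' (X × Bool))) n =
    if n = 0 then (CT X, true) else (qT (CT X), l) := by
  change lawL l X (CT _) n = _
  rw [lawL_C]
  cases n <;> rfl

theorem distL_q (l : Bool) (X : Type) (σ : Stream' (X × Bool)) :
    firstTrans ((distL l).law X (qT (Term.var σ))) = ((σ 1).2, Term.var (σ 2).1) := by
  change firstTrans (lawL l X (qT (Term.var σ))) = _
  rw [lawL_q, lawL_var]
  rfl

theorem distL_C_first (l : Bool) (X : Type) :
    firstTrans ((distL l).law X (CT (Stream' (X × Bool)))) = (true, qT (CT X)) := by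
  change firstTrans (lawL l X (CT _)) = _
  rw [lawL_C]
  rfl

/-- Let `A = {$, €}` be a two-element set of labels (realized as `Bool`, with
`$ := true` and `€ := false`), and consider the signature with one constant `C` and one
unary operation symbol `q`. The biGSOS law `ρ` with `ρ_X(C) = ($, q(C))` and
`ρ_X(q(x0 →a0 x1 →a1 x2 →a2 ⋯)) = (a1, x2)` extends to two distinct distributive laws
`λ ≠ λ'`; in particular they can be chosen so that `λ_∅(C)` is the stream
`C →$ q(C) →$ q(C) →$ ⋯` and `λ'_∅(C)` is the stream `C →$ q(C) →€ q(C) →€ ⋯`. -/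
theorem two_distinct_distLaws_extend :
    ∃ lam lam' : DistLaw Bool cqAr Bool,
      lam ≠ lam' ∧
      ((∀ X : Type,
          firstTrans (lam.law X (CT (Stream' (X × Bool)))) = (true, qT (CT X))) ∧
        (∀ (X : Type) (σ : Stream' (X × Bool)),
          firstTrans (lam.law X (qT (Term.var σ))) = ((σ 1).2, Term.var (σ 2).1))) ∧
      ((∀ X : Type,
          firstTrans (lam'.law X (CT (Stream' (X × Bool)))) = (true, qT (CT X))) ∧
        (∀ (X : Type) (σ : Stream' (X × Bool)),
          firstTrans (lam'.law X (qT (Term.var σ))) = ((σ 1).2, Term.var (σ 2).1))) ∧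
      (∀ n : ℕ, lam.law Empty (CT (Stream' (Empty × Bool))) n =
        if n = 0 then (CT Empty, true) else (qT (CT Empty), true)) ∧
      (∀ n : ℕ, lam'.law Empty (CT (Stream' (Empty × Bool))) n =
        if n = 0 then (CT Empty, true) else (qT (CT Empty), false)) := by
  refine ⟨distL true, distL false, ?_, ⟨distL_C_first _, distL_q _⟩,
    ⟨distL_C_first _, distL_q _⟩, distL_C true Empty, distL_C false Empty⟩
  intro h
  have h1 := distL_C true Empty 1
  rw [h, distL_C false Empty 1] at h1
  simp at h1
end

section
/- Let M be a queue machine and ρ_M the induced stream biGSOS law. For every n > 0, if M makes n − 1 steps from the initial configuration, (q1, w1) → (q2, w2) → ⋯ → (qn, wn) with w1 = $, then every distributive law λ that extends ρ_M maps the constant C ∈ Σ*(B^∞∅) (for ∅ the empty set of variables) to a stream λ_∅(C) ∈ B^∞(Σ*∅) that begins with τ0 →$ τ1 →a1 τ2 →a2 ⋯ →a_{n−1} τn, where each ai ∈ A is the last letter of w_{i+1} (the letter added to the queue in the i-th step of M), τ0 = C, and for each 1 ≤ i ≤ n, τi = q_i(τj) where 0 ≤ j < i is determined by i − j = |wi|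 (it then follows that a_j a_{j+1} ⋯ a_{i−1} = wi). -/
/-- The signature induced by a queue machine: one constant `C` (symbol `none`) and a
unary operation symbol for every state `q ∈ Q` (symbols `some q`). -/
def QM.Op (M : QM) : Type := Option M.Q

/-- Arities for the signature of a queue machine. -/
def QM.ar (M : QM) : M.Op → ℕ := fun o => o.elim 0 fun _ => 1

/-- The constant term `C`. -/
def QM.CT (M : QM) (X : Type) : Term M.Op M.ar X := Term.op none Fin.elim0

/-- Application of the unary operation symbol `q`. -/
def QM.qT (M : QM) {X : Type} (q : M.Q) (t : Term M.Op M.ar X) : Term M.Op M.ar X :=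
  Term.op (some q) fun _ => t

/-- A distributive law `λ` extends the biGSOS law `ρ_M` induced by the queue machine
`M` (given by the rules `C →$ q1(C)`; `q(x0 →a0 ⋯) →c q'(x0)` if `δ0(q) = (q', c)`;
`q(x0 →a0 x1 →a1 ⋯) →c q'(x1)` if `δ0(q)` is undefined and `δ1(q, a0) = (q', c)`;
`q(x0 →a0 x1 →a1 x2 →a2 ⋯) →c q'(x2)` if `δ0(q), δ1(q, a0)` are undefined and
`δ2(q, a0, a1) = (q', c)`) if for every set `X` and every `t ∈ Σ(B^∞ X)` the first
transition of `λ_X(ι(t))` (its first label together with its second state) equals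
`ρ_M` applied to `t`. -/
def QM.ExtendsRho (M : QM) (lam : DistLaw M.Op M.ar M.A) : Prop :=
  (∀ X : Type,
    firstTrans (lam.law X (M.CT (Stream' (X × M.A)))) = (M.dollar, M.qT M.q1 (M.CT X))) ∧
  (∀ (X : Type) (q : M.Q) (σ : Stream' (X × M.A)) (q' : M.Q) (c : M.A),
    M.d0 q = some (q', c) →
    firstTrans (lam.law X (M.qT q (Term.var σ))) = (c, M.qT q' (Term.var (σ 0).1))) ∧
  (∀ (X : Type) (q : M.Q) (σ : Stream' (X × M.A)) (q' : M.Q) (c : M.A),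
    M.d0 q = none → M.d1 q (σ 0).2 = some (q', c) →
    firstTrans (lam.law X (M.qT q (Term.var σ))) = (c, M.qT q' (Term.var (σ 1).1))) ∧
  (∀ (X : Type) (q : M.Q) (σ : Stream' (X × M.A)) (q' : M.Q) (c : M.A),
    M.d0 q = none → M.d1 q (σ 0).2 = none → M.d2 q (σ 0).2 (σ 1).2 = some (q', c) →
    firstTrans (lam.law X (M.qT q (Term.var σ))) = (c, M.qT q' (Term.var (σ 2).1)))

theorem drop_eq_law {Op : Type} {ar : Op → ℕ} {A : Type} (lam : DistLaw Op ar A)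
    (u : Term Op ar (Stream' (Empty × A)))
    (hu : u.map sTails = u.map (Stream'.map (Prod.map Empty.elim id))) (n : ℕ) :
    (lam.law Empty u).drop n =
      lam.law Empty (((lam.law Empty u) n).1.map Empty.elim) := by
  have h := lam.ax_comult Empty u
  rw [hu, lam.natural] at h
  have h2 := congrArg Prod.fst (congrFun h n)
  exact h2.symm

theorem step_aux (M : QM) (lam : DistLaw M.Op M.ar M.A)
    (s : Stream' (Term M.Op M.ar Empty × M.A))
    (hd : ∀ n, s.drop n = lam.law Empty ((s n).1.map Empty.elim))
    (i j k : ℕ) (q q' : M.Q) (c : M.A)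
    (hi : (s i).1 = M.qT q (s j).1)
    (hf : firstTrans (lam.law (Term M.Op M.ar Empty) (M.qT q (Term.var (s.drop j)))) =
      (c, M.qT q' (Term.var ((s.drop j) k).1))) :
    (s i).2 = c ∧ (s (i + 1)).1 = M.qT q' (s (j + k)).1 := by
  have h1 := hd i
  have h2 := lam.ax_mult Empty (M.qT q (Term.var ((s j).1.map Empty.elim)))
  have h3 : (M.qT q (Term.var ((s j).1.map Empty.elim)) :
      Term M.Op M.ar (Term M.Op M.ar (Stream' (Empty × M.A)))).join
      = (s i).1.map Empty.elim := by
    rw [hi]; rfl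
  have h4 : (M.qT q (Term.var ((s j).1.map Empty.elim)) :
      Term M.Op M.ar (Term M.Op M.ar (Stream' (Empty × M.A)))).map (lam.law Empty)
      = M.qT q (Term.var (s.drop j)) := by
    rw [hd j]; rfl
  rw [h3, h4, ← h1] at h2
  have e0 := congrArg Prod.snd (congrFun h2 0)
  have e1 := congrArg Prod.fst (congrFun h2 1)
  have f0 := congrArg Prod.fst hf
  have f1 := congrArg (fun p => Term.join p.2) hf
  have g0 : (s.drop i 0).2 = c := e0.trans f0
  have g1 : (s.drop i 1).1 = M.qT q' ((s.drop j) k).1 := e1.trans f1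
  have key : ∀ a b, s.drop a b = s (a + b) := by
    intro a b
    have : s.drop a b = s (b + a) := rfl
    rw [this, Nat.add_comm]
  rw [key] at g0 g1
  rw [key] at g1
  exact ⟨g0, g1⟩

/-- If a queue machine `M` makes `n−1` steps `(q1, w1) → (q2, w2) → ⋯ → (qn, wn)` from
the initial configuration (`w1 = $`), then every distributive law `λ` extending `ρ_M`
maps the constant `C ∈ Σ*(B^∞ ∅)` to a stream `λ_∅(C)` beginning with
`τ0 →$ τ1 →a1 τ2 →a2 ⋯ →a_{n−1} τn`, where each `ai` is the last letter of `w_{i+1}`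
(the letter added to the queue in the `i`-th step), `τ0 = C`, and for `1 ≤ i ≤ n`,
`τi = q_i(τ_j)` where `j = i − |w_i|`. -/
theorem distLaw_extension_follows_machine (M : QM) (n : ℕ) (hn : 0 < n)
    (cfg : ℕ → M.Q × List M.A)
    (hinit : cfg 1 = (M.q1, [M.dollar]))
    (hstep : ∀ i, 1 ≤ i → i < n → M.Step (cfg i) (cfg (i + 1)))
    (lam : DistLaw M.Op M.ar M.A) (hext : M.ExtendsRho lam) :
    ∀ s : Stream' (Term M.Op M.ar Empty × M.A),
      s = lam.law Empty (M.CT (Stream' (Empty × M.A))) →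
      (s 0).1 = M.CT Empty ∧ (s 0).2 = M.dollar ∧
      (∀ i, 1 ≤ i → i < n → (cfg (i + 1)).2.getLast? = some (s i).2) ∧
      (∀ i, 1 ≤ i → i ≤ n →
        (s i).1 = M.qT (cfg i).1 (s (i - (cfg i).2.length)).1) := by
  intro s hs
  obtain ⟨hC, h0, h1, h2⟩ := hext
  have hd : ∀ n, s.drop n = lam.law Empty ((s n).1.map Empty.elim) := by
    intro n
    rw [hs]
    apply drop_eq_law
    show Term.op _ _ = Term.op _ _
    congr 1
    funext x
    exact x.elim0
  have key : ∀ a b, s.drop a b = s (a + b) := by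
    intro a b
    have : s.drop a b = s (b + a) := rfl
    rw [this, Nat.add_comm]
  have c0 : (s 0).1 = M.CT Empty := by
    rw [hs, lam.ax_counit]
    show Term.op _ _ = Term.op _ _
    congr 1
    funext x
    exact x.elim0
  have cC := hC Empty
  rw [← hs] at cC
  have d0 : (s 0).2 = M.dollar := congrArg Prod.fst cC
  have t1 : (s 1).1 = M.qT M.q1 (s 0).1 := by
    rw [c0]; exact congrArg Prod.snd cC
  -- one machine step preserves the invariant
  have hone : ∀ i (x y : M.Q × List M.A), M.Step x y →
      (∃ j, i = j + x.2.length ∧ (∀ k a, x.2[k]? = some a → (s (j + k)).2 = a) ∧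
        (s i).1 = M.qT x.1 (s j).1) →
      y.2.getLast? = some (s i).2 ∧
      (∃ j, i + 1 = j + y.2.length ∧ (∀ k a, y.2[k]? = some a → (s (j + k)).2 = a) ∧
        (s (i + 1)).1 = M.qT y.1 (s j).1) := by
    have fin : ∀ i j m (w v : List M.A) (q' : M.Q) (c : M.A), v.length = m →
        i = j + (v ++ w).length →
        (∀ k a, (v ++ w)[k]? = some a → (s (j + k)).2 = a) →
        ((s i).2 = c ∧ (s (i + 1)).1 = M.qT q' (s (j + m)).1) →
        (w ++ [c]).getLast? = some (s i).2 ∧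
        (∃ j, i + 1 = j + (w ++ [c]).length ∧
          (∀ k a, (w ++ [c])[k]? = some a → (s (j + k)).2 = a) ∧
          (s (i + 1)).1 = M.qT q' (s j).1) := by
      rintro i j m w v q' c rfl hi hk ⟨hc, ht⟩
      refine ⟨by simp [hc], j + v.length, by simp at hi ⊢; omega, ?_, ht⟩
      intro k a hka
      by_cases hlt : k < w.length
      · have := hk (v.length + k) a (by
          rw [List.getElem?_append_right (by omega)]
          rw [List.getElem?_append_left hlt] at hka
          simpa using hka)
        rwa [← Nat.add_assoc] at this
      · rw [List.getElem?_append_right (by omega)] at hka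
        have hk0 : k - w.length = 0 := by
          by_contra hne
          rw [List.getElem?_eq_none (by simp; omega)] at hka
          exact absurd hka (by simp)
        have hkw : j + v.length + k = i := by simp at hi; omega
        rw [hk0] at hka
        rw [hkw, hc]
        simpa using hka
    rintro i x y hxy ⟨j, hi, hk, ht⟩
    cases hxy with
    | step0 e0 =>
      exact fin i j 0 _ [] _ _ rfl hi hk
        (step_aux M lam s hd i j 0 _ _ _ ht (h0 _ _ _ _ _ e0))
    | @step1 q a w q' c e0 e1 =>
      have ha : ((s.drop j) 0).2 = a := by rw [key]; exact hk 0 a rfl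
      refine fin i j 1 _ [a] _ _ rfl hi hk
        (step_aux M lam s hd i j 1 _ _ _ ht (h1 _ _ _ _ _ e0 ?_))
      rw [ha]; exact e1
    | @step2 q a b w q' c e0 e1 e2 =>
      have ha : ((s.drop j) 0).2 = a := by rw [key]; exact hk 0 a rfl
      have hb : ((s.drop j) 1).2 = b := by rw [key]; exact hk 1 b rfl
      refine fin i j 2 _ [a, b] _ _ rfl hi hk
        (step_aux M lam s hd i j 2 _ _ _ ht (h2 _ _ _ _ _ e0 ?_ ?_))
      · rw [ha]; exact e1
      · rw [ha, hb]; exact e2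
  have hinv : ∀ i, 1 ≤ i → i ≤ n →
      (∃ j, i = j + (cfg i).2.length ∧ (∀ k a, (cfg i).2[k]? = some a → (s (j + k)).2 = a) ∧
        (s i).1 = M.qT (cfg i).1 (s j).1) := by
    intro i hi
    induction i, hi using Nat.le_induction with
    | base =>
      intro _
      rw [hinit]
      refine ⟨0, rfl, ?_, t1⟩
      intro k a hka
      cases k with
      | zero =>
        have : M.dollar = a := by simpa using hka
        rw [← this]; exact d0
      | succ k => simp at hka
    | succ i hi ih =>
      intro hin
      exact (hone i _ _ (hstep i hi hin) (ih (by omega))).2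
  refine ⟨c0, d0, ?_, ?_⟩
  · intro i hi hin
    exact (hone i _ _ (hstep i hi hin) (hinv i hi hin.le)).1
  · intro i hi hin
    obtain ⟨j, hj, -, ht⟩ := hinv i hi hin
    have : i - (cfg i).2.length = j := by omega
    rw [this]; exact ht
end

section
/- Let M be a queue machine that does not terminate from the initial configuration (q1, $). Then there exists a distributive law λ that extends the induced stream biGSOS law ρ_M. -/
namespace QM
variable (M : QM)

/-- One (totalised) transition: new state, number of letters read, output. -/
def trans (q : M.Q) (a b : M.A) : M.Q × ℕ × M.A :=
  match M.d0 q with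
  | some (q', c) => (q', 0, c)
  | none => match M.d1 q a with
    | some (q', c) => (q', 1, c)
    | none => match M.d2 q a b with
      | some (q', c) => (q', 2, c)
      | none => (q, 0, a)

/-- State and reading position after `n` steps on the label stream `a`. -/
def run (a : ℕ → M.A) (q : M.Q) : ℕ → M.Q × ℕ
  | 0 => (q, 0)
  | n + 1 =>
    ((M.trans (run a q n).1 (a (run a q n).2) (a ((run a q n).2 + 1))).1,
      (run a q n).2 + (M.trans (run a q n).1 (a (run a q n).2) (a ((run a q n).2 + 1))).2.1)

/-- Output label at step `n`. -/
def out (a : ℕ → M.A) (q : M.Q) (n : ℕ) : M.A :=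
  (M.trans (M.run a q n).1 (a (M.run a q n).2) (a ((M.run a q n).2 + 1))).2.2

theorem run_add (a : ℕ → M.A) (q : M.Q) (m n : ℕ) :
    M.run a q (m + n) =
      ((M.run (fun i => a ((M.run a q m).2 + i)) (M.run a q m).1 n).1,
        (M.run a q m).2 + (M.run (fun i => a ((M.run a q m).2 + i)) (M.run a q m).1 n).2) := by
  induction n with
  | zero => simp [run]
  | succ n ih =>
    rw [← Nat.add_assoc]
    simp only [run]
    rw [ih]
    simp [Nat.add_assoc]

theorem out_add (a : ℕ → M.A) (q : M.Q) (m n : ℕ) :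
    M.out a q (m + n) = M.out (fun i => a ((M.run a q m).2 + i)) (M.run a q m).1 n := by
  simp only [out, run_add, Nat.add_assoc]

/-- The queue contents: the letters at positions `p, …, n`. -/
def window (h : ℕ → M.A) (p n : ℕ) : List M.A := (List.range' p (n + 1 - p)).map h

theorem window_cons (h : ℕ → M.A) {p n : ℕ} (hp : p ≤ n) :
    M.window h p n = h p :: M.window h (p + 1) n := by
  have e : n + 1 - p = (n + 1 - (p + 1)) + 1 := by omega
  simp only [window]
  rw [e, List.range'_succ, List.map_cons]

theorem window_nil (h : ℕ → M.A) {p n : ℕ} (hp : n < p) : M.window h p n = [] := by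
  have e : n + 1 - p = 0 := by omega
  simp [window, e]

theorem window_snoc (h : ℕ → M.A) {p n : ℕ} (hp : p ≤ n + 1) :
    M.window h p (n + 1) = M.window h p n ++ [h (n + 1)] := by
  have e : n + 1 + 1 - p = (n + 1 - p) + 1 := by omega
  have e2 : p + (n + 1 - p) = n + 1 := by omega
  simp only [window]
  rw [e, List.range'_concat, List.map_append]
  simp [e2]

theorem window_congr {h h' : ℕ → M.A} {p n : ℕ} (H : ∀ i ≤ n, h' i = h i) :
    M.window h' p n = M.window h p n := by
  simp only [window]
  refine List.map_congr_left fun i hi => H i ?_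
  rw [List.mem_range'_1] at hi
  omega

theorem step_ok (q : M.Q) (p n : ℕ) (h : ℕ → M.A) (hp : p ≤ n)
    (hns : ¬ M.Stuck (q, M.window h p n)) :
    p + (M.trans q (h p) (h (p + 1))).2.1 ≤ n + 1 ∧
    M.Step (q, M.window h p n) ((M.trans q (h p) (h (p + 1))).1,
      M.window h (p + (M.trans q (h p) (h (p + 1))).2.1) n ++
        [(M.trans q (h p) (h (p + 1))).2.2]) ∧
    ∀ b : ℕ → M.A, (∀ i ≤ n, b i = h i) →
      M.trans q (b p) (b (p + 1)) = M.trans q (h p) (h (p + 1)) := by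
  cases h0 : M.d0 q with
  | some x =>
    obtain ⟨q', c⟩ := x
    have ht : ∀ a b, M.trans q a b = (q', 0, c) := fun a b => by simp [trans, h0]
    simp only [ht]
    exact ⟨by omega, Step.step0 h0, fun _ _ => trivial⟩
  | none =>
    cases h1 : M.d1 q (h p) with
    | some x =>
      obtain ⟨q', c⟩ := x
      have ht : ∀ b, M.trans q (h p) b = (q', 1, c) := fun b => by simp [trans, h0, h1]
      simp only [ht]
      refine ⟨by omega, ?_, fun b hb => by rw [hb p hp, ht]⟩
      rw [M.window_cons h hp]
      exact Step.step1 h0 h1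
    | none =>
      have hlt : p + 1 ≤ n := by
        by_contra hcon
        apply hns
        intro c' hs
        rw [M.window_cons h hp, M.window_nil h (by omega)] at hs
        cases hs with
        | step0 e => simp [h0] at e
        | step1 _ e => simp [h1] at e
      cases h2 : M.d2 q (h p) (h (p + 1)) with
      | none =>
        have := M.exactOne q (h p) (h (p + 1))
        simp [h0, h1, h2] at this
      | some x =>
        obtain ⟨q', c⟩ := x
        have ht : M.trans q (h p) (h (p + 1)) = (q', 2, c) := by simp [trans, h0, h1, h2]
        refine ⟨by rw [ht]; simp only; omega, ?_, fun b hb => by rw [hb p hp, hb _ hlt]⟩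
        rw [ht, M.window_cons h hp, M.window_cons h hlt]
        exact Step.step2 h0 h1 h2

/-- Simulation of the machine: state, reading position, and history. -/
def sim : ℕ → M.Q × ℕ × (ℕ → M.A)
  | 0 => (M.q1, 0, fun _ => M.dollar)
  | n + 1 =>
    ((M.trans (sim n).1 ((sim n).2.2 (sim n).2.1) ((sim n).2.2 ((sim n).2.1 + 1))).1,
      (sim n).2.1 +
        (M.trans (sim n).1 ((sim n).2.2 (sim n).2.1) ((sim n).2.2 ((sim n).2.1 + 1))).2.1,
      Function.update (sim n).2.2 (n + 1)
        (M.trans (sim n).1 ((sim n).2.2 (sim n).2.1) ((sim n).2.2 ((sim n).2.1 + 1))).2.2)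

/-- The label stream of the constant. -/
def lab (n : ℕ) : M.A := (M.sim n).2.2 n

theorem sim_hist (n : ℕ) : ∀ i ≤ n, M.lab i = (M.sim n).2.2 i := by
  induction n with
  | zero => intro i hi; obtain rfl : i = 0 := by omega
            rfl
  | succ n ih =>
    intro i hi
    rcases Nat.lt_or_ge n i with h | h
    · obtain rfl : i = n + 1 := by omega
      rfl
    · rw [ih i h]
      simp only [sim]
      rw [Function.update_of_ne (by omega)]

theorem sim_inv (hnt : ¬ M.Terminates) (n : ℕ) :
    (M.sim n).2.1 ≤ n ∧
    Relation.ReflTransGen M.Step (M.q1, [M.dollar])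
      ((M.sim n).1, M.window (M.sim n).2.2 (M.sim n).2.1 n) := by
  induction n with
  | zero => exact ⟨le_rfl, Relation.ReflTransGen.refl⟩
  | succ n ih =>
    obtain ⟨hp, hr⟩ := ih
    obtain ⟨h1, h2, -⟩ := M.step_ok _ _ _ _ hp (fun hs => hnt ⟨_, hr, hs⟩)
    refine ⟨h1, hr.tail ?_⟩
    simp only [sim]
    rw [M.window_snoc _ h1, Function.update_self, M.window_congr (h := (M.sim n).2.2)
      (h' := Function.update (M.sim n).2.2 (n + 1) _)
      (fun i hi => Function.update_of_ne (by omega) _ _)]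
    exact h2

theorem sim_trans (hnt : ¬ M.Terminates) (n : ℕ) :
    M.trans (M.sim n).1 (M.lab (M.sim n).2.1) (M.lab ((M.sim n).2.1 + 1)) =
    M.trans (M.sim n).1 ((M.sim n).2.2 (M.sim n).2.1) ((M.sim n).2.2 ((M.sim n).2.1 + 1)) := by
  obtain ⟨hp, hr⟩ := M.sim_inv hnt n
  exact (M.step_ok _ _ _ _ hp (fun hs => hnt ⟨_, hr, hs⟩)).2.2 _ (M.sim_hist n)

theorem run_lab (hnt : ¬ M.Terminates) (n : ℕ) :
    M.run M.lab M.q1 n = ((M.sim n).1, (M.sim n).2.1) := by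
  induction n with
  | zero => rfl
  | succ n ih =>
    simp only [run, ih]
    rw [M.sim_trans hnt]
    rfl

theorem out_lab (hnt : ¬ M.Terminates) (n : ℕ) : M.out M.lab M.q1 n = M.lab (n + 1) := by
  rw [out, M.run_lab hnt]
  simp only
  rw [M.sim_trans hnt]
  simp [lab, sim]

theorem run_lab_le (hnt : ¬ M.Terminates) (n : ℕ) : (M.run M.lab M.q1 n).2 ≤ n := by
  rw [M.run_lab hnt]
  exact (M.sim_inv hnt n).1

/-- States of the behaviour of the constant. -/
def cT (X : Type) : ℕ → Term M.Op M.ar X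
  | 0 => M.CT X
  | n + 1 =>
    if _h : (M.run M.lab M.q1 n).2 < n + 1 then
      M.qT (M.run M.lab M.q1 n).1 (cT X (M.run M.lab M.q1 n).2)
    else M.CT X

theorem cT_zero (X : Type) : M.cT X 0 = M.CT X := by rw [cT]

theorem cT_succ (hnt : ¬ M.Terminates) (X : Type) (n : ℕ) : M.cT X (n + 1) =
    M.qT (M.run M.lab M.q1 n).1 (M.cT X (M.run M.lab M.q1 n).2) := by
  rw [cT, dif_pos (Nat.lt_succ_of_le (M.run_lab_le hnt n))]

/-- The behaviour of the constant. -/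
def cS (X : Type) : Stream' (Term M.Op M.ar X × M.A) := fun n => (M.cT X n, M.lab n)

/-- The action of a state on streams of terms. -/
def tr {X : Type} (q : M.Q) (s : Stream' (Term M.Op M.ar X × M.A)) :
    Stream' (Term M.Op M.ar X × M.A) := fun n =>
  (M.qT (M.run (fun i => (s i).2) q n).1 (s (M.run (fun i => (s i).2) q n).2).1,
    M.out (fun i => (s i).2) q n)

/-- Interpretation of the operation symbols. -/
def opS (X : Type) : (o : M.Op) → (Fin (M.ar o) → Stream' (Term M.Op M.ar X × M.A)) →
    Stream' (Term M.Op M.ar X × M.A)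
  | none, _ => M.cS X
  | some q, f => M.tr q (f (0 : Fin 1))

/-- The distributive law. -/
def lam (X : Type) : Term M.Op M.ar (Stream' (X × M.A)) → Stream' (Term M.Op M.ar X × M.A)
  | .var σ => Stream'.map (Prod.map Term.var id) σ
  | .op o ts => M.opS X o fun i => lam X (ts i)

theorem lam_CT (X : Type) : M.lam X (M.CT _) = M.cS X := rfl

theorem lam_qT (X : Type) (q : M.Q) (t : Term M.Op M.ar (Stream' (X × M.A))) :
    M.lam X (M.qT q t) = M.tr q (M.lam X t) := rfl

theorem map_CT {X Y : Type} (f : X → Y) : (M.CT X).map f = M.CT Y := by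
  simp only [CT, Term.map]
  congr 1
  funext i
  exact Fin.elim0 i

theorem map_qT {X Y : Type} (f : X → Y) (q : M.Q) (t : Term M.Op M.ar X) :
    (M.qT q t).map f = M.qT q (t.map f) := rfl

theorem join_CT (X : Type) : (M.CT (Term M.Op M.ar X)).join = M.CT X := by
  simp only [CT, Term.join]
  congr 1
  funext i
  exact Fin.elim0 i

theorem join_qT {X : Type} (q : M.Q) (t : Term M.Op M.ar (Term M.Op M.ar X)) :
    (M.qT q t).join = M.qT q t.join := rfl

theorem term_ind {X : Type} {P : Term M.Op M.ar X → Prop} (hv : ∀ x, P (.var x))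
    (hC : P (M.CT X)) (hq : ∀ q t, P t → P (M.qT q t)) (t : Term M.Op M.ar X) : P t := by
  induction t with
  | var x => exact hv x
  | op o ts ih =>
    match o, ts, ih with
    | none, ts, _ =>
      have : ts = Fin.elim0 := by funext i; exact Fin.elim0 i
      subst this
      exact hC
    | some q, ts, ih =>
      have : ts = fun _ => ts (0 : Fin 1) := by
        funext i
        exact congrArg ts (Subsingleton.elim (α := Fin 1) i 0)
      rw [this]
      exact hq q _ (ih (0 : Fin 1))

theorem map_cT (hnt : ¬ M.Terminates) {X Y : Type}
    (g : Term M.Op M.ar X → Term M.Op M.ar Y) (gC : g (M.CT X) = M.CT Y)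
    (gq : ∀ q t, g (M.qT q t) = M.qT q (g t)) (n : ℕ) : g (M.cT X n) = M.cT Y n := by
  induction n using Nat.strong_induction_on with
  | _ n ih =>
    cases n with
    | zero => rw [cT_zero, cT_zero, gC]
    | succ n =>
      rw [M.cT_succ hnt, M.cT_succ hnt, gq, ih _ (Nat.lt_succ_of_le (M.run_lab_le hnt n))]

theorem map_cS (hnt : ¬ M.Terminates) {X Y : Type}
    (g : Term M.Op M.ar X → Term M.Op M.ar Y) (gC : g (M.CT X) = M.CT Y)
    (gq : ∀ q t, g (M.qT q t) = M.qT q (g t)) :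
    Stream'.map (Prod.map g id) (M.cS X) = M.cS Y := by
  funext n
  exact Prod.ext (M.map_cT hnt g gC gq n) rfl

theorem map_tr {X Y : Type}
    (g : Term M.Op M.ar X → Term M.Op M.ar Y)
    (gq : ∀ q t, g (M.qT q t) = M.qT q (g t)) (q : M.Q)
    (s : Stream' (Term M.Op M.ar X × M.A)) :
    Stream'.map (Prod.map g id) (M.tr q s) = M.tr q (Stream'.map (Prod.map g id) s) := by
  funext n
  exact Prod.ext (gq _ _) rfl

theorem tr_drop {X : Type} (q : M.Q) (s : Stream' (Term M.Op M.ar X × M.A)) (n : ℕ) :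
    (M.tr q s).drop n =
      M.tr (M.run (fun i => (s i).2) q n).1 (s.drop (M.run (fun i => (s i).2) q n).2) := by
  have hd : ∀ (Z : Type) (z : Stream' Z) (k i : ℕ), z.drop k i = z (k + i) := by
    intro Z z k i
    show z (i + k) = z (k + i)
    rw [Nat.add_comm]
  funext m
  rw [hd]
  simp only [tr, hd]
  rw [M.run_add, M.out_add]

theorem cS_tail (hnt : ¬ M.Terminates) (X : Type) : (M.cS X).drop 1 = M.tr M.q1 (M.cS X) := by
  funext n
  show (M.cT X (n + 1), M.lab (n + 1)) = _
  rw [M.cT_succ hnt, ← M.out_lab hnt]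
  rfl

theorem lam_cT (hnt : ¬ M.Terminates) (X : Type) (n : ℕ) :
    M.lam X (M.cT _ n) = (M.cS X).drop n := by
  induction n using Nat.strong_induction_on with
  | _ n ih =>
    cases n with
    | zero => rw [cT_zero, lam_CT]; rfl
    | succ n =>
      rw [M.cT_succ hnt, lam_qT, ih _ (Nat.lt_succ_of_le (M.run_lab_le hnt n))]
      have h := M.tr_drop M.q1 (M.cS X) n
      rw [← M.cS_tail hnt, Stream'.drop_drop] at h
      rw [Nat.add_comm n 1]
      exact h.symm

/-- The distributive law of a non-terminating queue machine. -/
def distLaw (hnt : ¬ M.Terminates) : DistLaw M.Op M.ar M.A where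
  law := M.lam
  natural X Y f u := by
    induction u using M.term_ind with
    | hv σ => rfl
    | hC => rw [map_CT, lam_CT, lam_CT, M.map_cS hnt _ (M.map_CT f) (fun _ _ => rfl)]
    | hq q t ih => rw [map_qT, lam_qT, lam_qT, ih, M.map_tr _ (fun _ _ => rfl)]
  ax_unit X σ := rfl
  ax_counit X u := by
    induction u using M.term_ind with
    | hv σ => rfl
    | hC => rw [map_CT, lam_CT]; exact M.cT_zero X
    | hq q t ih => rw [map_qT, lam_qT, ← ih]; rfl
  ax_mult X u := by
    induction u using M.term_ind with
    | hv t => rfl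
    | hC =>
      rw [map_CT, join_CT, lam_CT, lam_CT, M.map_cS hnt _ (M.join_CT X) (fun _ _ => rfl)]
    | hq q t ih => rw [map_qT, join_qT, lam_qT, lam_qT, ih, M.map_tr _ (fun _ _ => rfl)]
  ax_comult X u := by
    induction u using M.term_ind with
    | hv σ => rfl
    | hC =>
      rw [map_CT, lam_CT, lam_CT]
      funext n
      exact Prod.ext (M.lam_cT hnt X n) rfl
    | hq q t ih =>
      rw [map_qT, lam_qT, lam_qT]
      have h2 : (fun i => (M.lam _ (t.map sTails) i).2) = fun i => (M.lam X t i).2 := by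
        funext i
        exact congrArg Prod.snd (congrFun ih i)
      have h1 : ∀ i, M.lam X (M.lam _ (t.map sTails) i).1 = (M.lam X t).drop i := by
        intro i
        exact congrArg Prod.fst (congrFun ih i)
      funext n
      refine Prod.ext ?_ ?_
      · show M.lam X (M.tr q (M.lam _ (t.map sTails)) n).1 = (M.tr q (M.lam X t)).drop n
        rw [tr_drop]
        simp only [tr]
        rw [lam_qT, h1, h2]
      · show M.out _ q n = M.out _ q n
        rw [h2]

theorem distLaw_extends (hnt : ¬ M.Terminates) : M.ExtendsRho (M.distLaw hnt) := by
  refine ⟨fun X => ?_, fun X q σ q' c h0 => ?_, fun X q σ q' c h0 h1 => ?_,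
    fun X q σ q' c h0 h1 h2 => ?_⟩
  · show (M.lab 0, M.cT X (0 + 1)) = _
    rw [M.cT_succ hnt]
    show (_, M.qT M.q1 (M.cT X 0)) = _
    rw [cT_zero]
    rfl
  all_goals
    show ((M.trans q (σ 0).2 (σ 1).2).2.2,
      M.qT (M.trans q (σ 0).2 (σ 1).2).1
        (Term.var (σ (0 + (M.trans q (σ 0).2 (σ 1).2).2.1)).1)) = _
  · have ht : M.trans q (σ 0).2 (σ 1).2 = (q', 0, c) := by simp [trans, h0]
    rw [ht]
    rfl
  · have ht : M.trans q (σ 0).2 (σ 1).2 = (q', 1, c) := by simp [trans, h0, h1]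
    rw [ht]
    rfl
  · have ht : M.trans q (σ 0).2 (σ 1).2 = (q', 2, c) := by simp [trans, h0, h1, h2]
    rw [ht]
    rfl

end QM

/-- If a queue machine `M` does not terminate from the initial configuration `(q1, $)`,
then there exists a distributive law `λ` that extends the induced stream biGSOS law
`ρ_M`. -/
theorem exists_distLaw_extends (M : QM) (hnt : ¬ M.Terminates) :
    ∃ lam : DistLaw M.Op M.ar M.A, M.ExtendsRho lam := 
  ⟨M.distLaw hnt, M.distLaw_extends hnt⟩
end

section
/- Let M be a queue machine that terminates from the initial configuration (q1, $). Then no distributive law extends the induced stream biGSOS law ρ_M. -/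
/-- Number of operation symbols in a term. -/
def Term.opCount {Op : Type} {ar : Op → ℕ} {X : Type} : Term Op ar X → ℕ
  | .var _ => 0
  | .op _ ts => (∑ i, (ts i).opCount) + 1

theorem QM.size_qT (M : QM) {X : Type} (q : M.Q) (t : Term M.Op M.ar X) :
    (M.qT q t).opCount = t.opCount + 1 := by
  have : (M.qT q t).opCount = (∑ _i : Fin 1, t.opCount) + 1 := rfl
  rw [this]; simp

theorem QM.qT_ne (M : QM) {X : Type} (q : M.Q) (t : Term M.Op M.ar X) : t ≠ M.qT q t := by
  intro h
  have := congrArg Term.opCount h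
  rw [QM.size_qT] at this
  omega

namespace QMProof
variable (M : QM) (lam : DistLaw M.Op M.ar M.A)

/-- The stream of the constant. -/
def s : Stream' (Term M.Op M.ar Empty × M.A) := lam.law Empty (M.CT _)

/-- Closed terms seen over any variables. -/
def emb {Y : Type} (t : Term M.Op M.ar Empty) : Term M.Op M.ar Y := t.map Empty.elim

theorem CT_map {X Y : Type} (f : X → Y) : (M.CT X).map f = M.CT Y := by
  show Term.op none _ = Term.op none _
  congr 1
  funext i
  exact Fin.elim0 i

theorem law_emb (n : ℕ) : lam.law Empty (emb M (s M lam n).1) = (s M lam).drop n := by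
  have h := congrFun (lam.ax_comult Empty (M.CT _)) n
  rw [CT_map] at h
  have h2 := lam.natural Empty (Stream' (Empty × M.A)) Empty.elim (M.CT _)
  rw [CT_map] at h2
  rw [h2] at h
  exact congrArg Prod.fst h

theorem law_q (m k : ℕ) (q : M.Q) (h : (s M lam m).1 = M.qT q (s M lam k).1) :
    (s M lam).drop m = Stream'.map (Prod.map Term.join id)
      (lam.law (Term M.Op M.ar Empty) (M.qT q (Term.var ((s M lam).drop k)))) := by
  rw [← law_emb M lam m, h, ← law_emb M lam k]
  exact lam.ax_mult Empty (M.qT q (Term.var (emb M (s M lam k).1)))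

theorem drop_at {α : Type} (σ : Stream' α) (k i : ℕ) : (σ.drop k) i = σ (k + i) := by
  show σ (i + k) = σ (k + i)
  rw [add_comm]

theorem first (m k j : ℕ) (q q' : M.Q) (c : M.A) (h : (s M lam m).1 = M.qT q (s M lam k).1)
    (hf : firstTrans (lam.law (Term M.Op M.ar Empty) (M.qT q (Term.var ((s M lam).drop k))))
      = (c, M.qT q' (Term.var (((s M lam).drop k) j).1))) :
    (s M lam m).2 = c ∧ (s M lam (m+1)).1 = M.qT q' (s M lam (k + j)).1 := by
  have e := law_q M lam m k q h
  have e0 := congrArg Prod.snd (congrFun e 0)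
  have e1 := congrArg Prod.fst (congrFun e 1)
  rw [drop_at] at e0 e1
  rw [drop_at] at hf
  constructor
  · exact e0.trans (congrArg Prod.fst hf)
  · exact e1.trans (congrArg Term.join (congrArg Prod.snd hf))

/-- The invariant linking queue configurations with the stream. -/
def Inv (cfg : M.Q × List M.A) : Prop :=
  ∃ k, (s M lam (k + cfg.2.length)).1 = M.qT cfg.1 (s M lam k).1 ∧
    ∀ i (h : i < cfg.2.length), cfg.2[i] = (s M lam (k + i)).2

variable {M lam}

theorem inv_init (H : M.ExtendsRho lam) : Inv M lam (M.q1, [M.dollar]) := by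
  have h := H.1 Empty
  refine ⟨0, ?_, ?_⟩
  · have h0 : (s M lam 0).1 = M.CT _ := by
      have := lam.ax_counit Empty (M.CT _)
      rw [CT_map] at this
      exact this
    simp only [List.length_singleton]
    rw [h0]
    exact congrArg Prod.snd h
  · intro i hi
    have : i = 0 := by simpa using hi
    subst this
    exact (congrArg Prod.fst h).symm

theorem inv_step (H : M.ExtendsRho lam) {c1 c2} (hs : M.Step c1 c2) (hi : Inv M lam c1) : Inv M lam c2 := by
  obtain ⟨k, h, hw⟩ := hi
  have aux : ∀ (v w : List M.A) (c : M.A), (∀ i (h : i < (v ++ w).length),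
      (v ++ w)[i] = (s M lam (k + i)).2) → (s M lam (k + (v ++ w).length)).2 = c →
      ∀ i (h : i < (w ++ [c]).length), (w ++ [c])[i] = (s M lam (k + v.length + i)).2 := by
    intro v w c hw hc i hi
    by_cases hl : i < w.length
    · have := hw (v.length + i) (by simp; omega)
      rw [List.getElem_append_left hl, add_assoc, ← this]
      simp
    · have : i = w.length := by simp at hi; omega
      subst this
      simp [← hc, add_assoc]
  cases hs with
  | @step0 q w q' c hd =>
    obtain ⟨ha, hb⟩ := first M lam _ k 0 q q' c h (H.2.1 _ q _ q' c hd)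
    refine ⟨k, ?_, aux [] w c hw ha⟩
    simpa [add_assoc] using hb
  | @step1 q a w q' c hd hd1 =>
    have h0 : a = (s M lam k).2 := hw 0 (by simp)
    obtain ⟨ha, hb⟩ := first M lam _ k 1 q q' c h
      (H.2.2.1 _ q _ q' c hd (by rw [drop_at]; exact h0 ▸ hd1))
    refine ⟨k + 1, ?_, aux [a] w c hw ha⟩
    rw [← hb]
    congr 2
    simp; omega
  | @step2 q a b w q' c hd hd1 hd2 =>
    have h0 : a = (s M lam k).2 := hw 0 (by simp)
    have h1 : b = (s M lam (k+1)).2 := hw 1 (by simp)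
    obtain ⟨ha, hb⟩ := first M lam _ k 2 q q' c h
      (H.2.2.2 _ q _ q' c hd (by rw [drop_at]; exact h0 ▸ hd1)
        (by rw [drop_at, drop_at]; subst h0 h1; exact hd2))
    refine ⟨k + 2, ?_, aux [a, b] w c hw ha⟩
    rw [← hb]
    congr 2
    simp; omega

theorem not_stuck (H : M.ExtendsRho lam) {cfg} (hi : Inv M lam cfg) (hst : M.Stuck cfg) : False := by
  obtain ⟨q, w⟩ := cfg
  obtain ⟨k, h, hw⟩ := hi
  have key : M.d0 q = none := by
    cases hd : M.d0 q with
    | none => rfl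
    | some p => exact absurd (QM.Step.step0 hd) (hst (p.1, w ++ [p.2]))
  match w with
  | [] => exact M.qT_ne q _ h
  | [a] =>
    have hd := key
    have h0 : a = (s M lam k).2 := hw 0 (by simp)
    have hd1 : M.d1 q a = none := by
      cases hd1 : M.d1 q a with
      | none => rfl
      | some p => exact absurd (QM.Step.step1 hd hd1) (hst _)
    have hd2 : (M.d2 q a (s M lam (k+1)).2).isSome := by
      have := M.exactOne q a (s M lam (k+1)).2
      simpa [hd, hd1] using this
    obtain ⟨⟨q', c⟩, hp⟩ := Option.isSome_iff_exists.1 hd2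
    obtain ⟨ha, hb⟩ := first M lam _ k 2 q q' c h
      (H.2.2.2 _ q _ q' c hd (by rw [drop_at]; exact h0 ▸ hd1)
        (by rw [drop_at, drop_at]; subst h0; exact hp))
    exact M.qT_ne q' _ hb
  | a :: b :: w =>
    have hd := key
    have hd1 : M.d1 q a = none := by
      cases hd1 : M.d1 q a with
      | none => rfl
      | some p => exact absurd (QM.Step.step1 hd hd1) (hst _)
    have hd2 : (M.d2 q a b).isSome := by
      have := M.exactOne q a b
      simpa [hd, hd1] using this
    obtain ⟨⟨q', c⟩, hp⟩ := Option.isSome_iff_exists.1 hd2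
    exact hst _ (QM.Step.step2 hd hd1 hp)

end QMProof

/-- If a queue machine `M` terminates from the initial configuration `(q1, $)`, then
no distributive law extends the induced stream biGSOS law `ρ_M`. -/
theorem no_distLaw_extends_of_terminates (M : QM) (ht : M.Terminates) :
    ¬ ∃ lam : DistLaw M.Op M.ar M.A, M.ExtendsRho lam := by
  rintro ⟨lam, H⟩
  obtain ⟨cfg, hr, hst⟩ := ht
  have hi : QMProof.Inv M lam cfg := by
    clear hst
    induction hr with
    | refl => exact QMProof.inv_init H
    | tail _ hs ih => exact QMProof.inv_step H hs ih
  exact QMProof.not_stuck H hi hst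
end
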